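/- Let r ≥ 3 be fixed. There exist constants C > 0 and δ > 0 depending only on r such that the following holds for every degree sequence k with sum M divisible by r, k_max ≥ 2 and k_max^3 ≤ δM. For every integer ℓ with 1 ≤ ℓ ≤ N such that the sets C_0, C_1, …, C_ℓ are all nonempty, one has |C_ℓ| = |C_{ℓ−1}| · ((r−1)M_2/(2ℓM)) · (1 + E) for some real E with |E| ≤ C·(k_max^3 + ℓ·k_max)/M_2. -/

import Mathlib

open scoped Classical BigOperators

/-- The set of points for the configuration model: cell `i` contains `k i` points. -/
abbrev Pts {n : ℕ} (k : Fin n → ℕ) : Type := (i : Fin n) × Fin (k i)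

/-- `M`, the total degree. -/
def Mtot {n : ℕ} (k : Fin n → ℕ) : ℕ := ∑ i, k i

/-- `M₂ = Σ kᵢ(kᵢ−1)`. -/
def M2 {n : ℕ} (k : Fin n → ℕ) : ℕ := ∑ i, k i * (k i - 1)

/-- `M₃ = Σ kᵢ(kᵢ−1)(kᵢ−2)`. -/
def M3 {n : ℕ} (k : Fin n → ℕ) : ℕ := ∑ i, k i * (k i - 1) * (k i - 2)

/-- The maximum degree. -/
def kmax {n : ℕ} (k : Fin n → ℕ) : ℕ := Finset.univ.sup k

/-- `Q` is an unordered partition of the point set into parts of size `r`. -/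
def IsPartition {n : ℕ} (r : ℕ) (k : Fin n → ℕ) (Q : Finset (Finset (Pts k))) : Prop :=
  (∀ U ∈ Q, U.card = r) ∧ ∀ p : Pts k, ∃! U, U ∈ Q ∧ p ∈ U

/-- `Λ_r(k)`, the set of partitions of the points into parts of size `r`. -/
def Lam {n : ℕ} (r : ℕ) (k : Fin n → ℕ) : Set (Finset (Finset (Pts k))) :=
  {Q | IsPartition r k Q}

/-- `Λ_r(k)` as a finset. -/
noncomputable def LamFinset {n : ℕ} (r : ℕ) (k : Fin n → ℕ) :
    Finset (Finset (Finset (Pts k))) :=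
  Finset.univ.filter fun Q => IsPartition r k Q

/-- The set of vertices of the edge of `G(Q)` corresponding to a part `U`. -/
def vset {n : ℕ} {k : Fin n → ℕ} (U : Finset (Pts k)) : Finset (Fin n) :=
  U.image Sigma.fst

/-- Multiplicity of vertex `i` in the edge corresponding to a part `U`. -/
def mult {n : ℕ} {k : Fin n → ℕ} (U : Finset (Pts k)) (i : Fin n) : ℕ :=
  (U.filter fun p => p.1 = i).card

/-- `U` contains a loop: two distinct points lying in the same cell. -/
def HasLoop {n : ℕ} {k : Fin n → ℕ} (U : Finset (Pts k)) : Prop :=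
  ∃ x ∈ U, ∃ y ∈ U, x ≠ y ∧ x.1 = y.1

/-- The number of parts of `Q` which contain a loop. -/
noncomputable def nloops {n : ℕ} {k : Fin n → ℕ} (Q : Finset (Finset (Pts k))) : ℕ :=
  (Q.filter fun U => HasLoop U).card

/-- `N = max(⌈log M⌉, ⌈9(r−1)M₂/M⌉)`. -/
noncomputable def Nbound {n : ℕ} (r : ℕ) (k : Fin n → ℕ) : ℕ :=
  max ⌈Real.log (Mtot k)⌉₊ ⌈(9 * ((r : ℝ) - 1) * (M2 k : ℝ)) / (Mtot k : ℝ)⌉₊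

/-- `Λ_r⁺(k)`: partitions satisfying properties (i)–(iv). -/
noncomputable def LamPlus {n : ℕ} (r : ℕ) (k : Fin n → ℕ) :
    Set (Finset (Finset (Pts k))) :=
  {Q | IsPartition r k Q ∧
    (∀ U ∈ Q, ∀ i, mult U i ≤ 2) ∧
    (∀ U ∈ Q, ∀ i j, mult U i = 2 → mult U j = 2 → i = j) ∧
    (∀ U ∈ Q, ∀ W ∈ Q, U ≠ W → (vset U ∩ vset W).card ≤ 2) ∧
    nloops Q ≤ Nbound r k}

/-- `C_ℓ`: partitions in `Λ_r⁺(k)` with exactly `ℓ` parts containing a loop. -/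
noncomputable def Cset {n : ℕ} (r : ℕ) (k : Fin n → ℕ) (ℓ : ℕ) :
    Set (Finset (Finset (Pts k))) :=
  {Q ∈ LamPlus r k | nloops Q = ℓ}

/-- The result of an ℓ-switching replacing parts `U`, `W₁`, `W₂`. -/
def switchResult {n : ℕ} {k : Fin n → ℕ} (Q : Finset (Finset (Pts k)))
    (U W₁ W₂ : Finset (Pts k)) (x₁ x₂ y₁ y₂ : Pts k) : Finset (Finset (Pts k)) :=
  (Q \ {U, W₁, W₂}) ∪
    {(U \ {x₁, x₂}) ∪ {y₁, y₂}, (W₁ \ {y₁}) ∪ {x₁}, (W₂ \ {y₂}) ∪ {x₂}}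

/-- `(x₁,x₂,y₁,y₂)` specifies an ℓ-switching in `Q` with parts `U`, `W₁`, `W₂`. -/
def IsSwitching {n : ℕ} {k : Fin n → ℕ} (Q : Finset (Finset (Pts k)))
    (U W₁ W₂ : Finset (Pts k)) (x₁ x₂ y₁ y₂ : Pts k) : Prop :=
  U ∈ Q ∧ W₁ ∈ Q ∧ W₂ ∈ Q ∧ U ≠ W₁ ∧ U ≠ W₂ ∧ W₁ ≠ W₂ ∧
  x₁ ∈ U ∧ x₂ ∈ U ∧ x₁ ≠ x₂ ∧ x₁.1 = x₂.1 ∧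
  y₁ ∈ W₁ ∧ y₂ ∈ W₂ ∧ y₁.1 ≠ y₂.1

/-- The result of a reverse ℓ-switching replacing parts `Û`, `Ŵ₁`, `Ŵ₂`. -/
def revSwitchResult {n : ℕ} {k : Fin n → ℕ} (Q' : Finset (Finset (Pts k)))
    (Uh W₁h W₂h : Finset (Pts k)) (x₁ x₂ y₁ y₂ : Pts k) : Finset (Finset (Pts k)) :=
  (Q' \ {Uh, W₁h, W₂h}) ∪
    {(Uh \ {y₁, y₂}) ∪ {x₁, x₂}, (W₁h \ {x₁}) ∪ {y₁}, (W₂h \ {x₂}) ∪ {y₂}}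

/-- `(x₁,x₂,y₁,y₂)` specifies a reverse ℓ-switching in `Q'` with parts `Û`, `Ŵ₁`, `Ŵ₂`. -/
def IsRevSwitching {n : ℕ} {k : Fin n → ℕ} (Q' : Finset (Finset (Pts k)))
    (Uh W₁h W₂h : Finset (Pts k)) (x₁ x₂ y₁ y₂ : Pts k) : Prop :=
  Uh ∈ Q' ∧ W₁h ∈ Q' ∧ W₂h ∈ Q' ∧ Uh ≠ W₁h ∧ Uh ≠ W₂h ∧ W₁h ≠ W₂h ∧
  x₁ ∈ W₁h ∧ x₂ ∈ W₂h ∧ x₁.1 = x₂.1 ∧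
  y₁ ∈ Uh ∧ y₂ ∈ Uh ∧ y₁ ≠ y₂ ∧ y₁.1 ≠ y₂.1

/-- `Q` is simple: every edge of `G(Q)` consists of distinct vertices and all
edges are distinct. -/
def SimpleQ {n : ℕ} {k : Fin n → ℕ} (Q : Finset (Finset (Pts k))) : Prop :=
  (∀ U ∈ Q, (vset U).card = U.card) ∧
  ∀ U ∈ Q, ∀ W ∈ Q, U ≠ W → vset U ≠ vset W

/-- `|H_r(k)|`: the number of simple `r`-uniform hypergraphs on `{1,…,n}` with
degree sequence `k`, a hypergraph being recorded as its (distinct) edge set. -/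
noncomputable def Hcount (r : ℕ) {n : ℕ} (k : Fin n → ℕ) : ℕ :=
  Set.ncard {E : Finset (Finset (Fin n)) |
    (∀ e ∈ E, e.card = r) ∧ ∀ i, (E.filter fun e => i ∈ e).card = k i}


section Helpers

variable {n : ℕ} {k : Fin n → ℕ}

/-- apply a permutation of points to a partition -/
def img (σ : Equiv.Perm (Pts k)) (Q : Finset (Finset (Pts k))) : Finset (Finset (Pts k)) :=
  Q.image (fun U => U.image σ)

/-- the part containing a point -/
noncomputable def pt (Q : Finset (Finset (Pts k))) (p : Pts k) : Finset (Pts k) :=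
  Classical.epsilon (fun U => U ∈ Q ∧ p ∈ U)

/-- some part meets both `A` and `B` -/
def Near (Q : Finset (Finset (Pts k))) (A B : Finset (Pts k)) : Prop :=
  ∃ e ∈ Q, ¬ Disjoint (vset e) (vset A) ∧ ¬ Disjoint (vset e) (vset B)

lemma pt_spec {r : ℕ} {Q : Finset (Finset (Pts k))} (hQ : IsPartition r k Q) (p : Pts k) :
    pt Q p ∈ Q ∧ p ∈ pt Q p :=
  Classical.epsilon_spec (p := fun U => U ∈ Q ∧ p ∈ U) (hQ.2 p).exists

lemma pt_eq {r : ℕ} {Q : Finset (Finset (Pts k))} (hQ : IsPartition r k Q) {p : Pts k}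
    {U : Finset (Pts k)} (hU : U ∈ Q) (hp : p ∈ U) : pt Q p = U :=
  (hQ.2 p).unique (pt_spec hQ p) ⟨hU, hp⟩

lemma image_perm_inj (σ : Equiv.Perm (Pts k)) :
    Function.Injective (fun U : Finset (Pts k) => U.image σ) :=
  Finset.image_injective σ.injective

lemma img_injective (σ : Equiv.Perm (Pts k)) : Function.Injective (img σ) :=
  Finset.image_injective (image_perm_inj σ)

lemma mem_img_of_mem (σ : Equiv.Perm (Pts k)) {Q : Finset (Finset (Pts k))} {U}
    (hU : U ∈ Q) : U.image σ ∈ img σ Q :=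
  Finset.mem_image_of_mem _ hU

lemma isPartition_img {r : ℕ} {Q : Finset (Finset (Pts k))} (hQ : IsPartition r k Q)
    (σ : Equiv.Perm (Pts k)) : IsPartition r k (img σ Q) := by
  refine ⟨?_, fun p => ?_⟩
  · intro U hU
    obtain ⟨V, hV, rfl⟩ := Finset.mem_image.1 hU
    rw [Finset.card_image_of_injective _ σ.injective]
    exact hQ.1 V hV
  · refine ⟨(pt Q (σ.symm p)).image σ, ⟨mem_img_of_mem σ (pt_spec hQ _).1, ?_⟩, ?_⟩
    · exact Finset.mem_image.2 ⟨σ.symm p, (pt_spec hQ _).2, by simp⟩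
    · rintro U ⟨hU, hp⟩
      obtain ⟨V, hV, rfl⟩ := Finset.mem_image.1 hU
      obtain ⟨q, hq, rfl⟩ := Finset.mem_image.1 hp
      rw [pt_eq hQ hV (by simpa using hq)]

lemma mem_vset {A : Finset (Pts k)} {i : Fin n} : i ∈ vset A ↔ ∃ p ∈ A, p.1 = i := by
  simp [vset]

lemma fst_mem_vset {A : Finset (Pts k)} {p : Pts k} (h : p ∈ A) : p.1 ∈ vset A :=
  mem_vset.2 ⟨p, h, rfl⟩

lemma vset_card_le (A : Finset (Pts k)) : (vset A).card ≤ A.card := Finset.card_image_le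

lemma not_hasLoop_iff {A : Finset (Pts k)} : ¬ HasLoop A ↔ A.card ≤ (vset A).card := by
  have h1 : ¬ HasLoop A ↔ Set.InjOn (Sigma.fst : Pts k → Fin n) (A : Set (Pts k)) := by
    unfold HasLoop Set.InjOn
    push Not
    constructor
    · intro h x hx y hy hxy
      by_contra hne
      exact h x hx y hy hne hxy
    · intro h x hx y hy hne hxy
      exact hne (h hx hy hxy)
  rw [h1, ← Finset.card_image_iff]
  have := vset_card_le A
  unfold vset at *
  omega

lemma sum_mult (A : Finset (Pts k)) : ∑ i ∈ vset A, mult A i = A.card := by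
  unfold mult
  exact (Finset.card_eq_sum_card_fiberwise (fun x hx => fst_mem_vset hx)).symm

lemma mult_pos {A : Finset (Pts k)} {i : Fin n} (h : i ∈ vset A) : 1 ≤ mult A i := by
  obtain ⟨p, hp, rfl⟩ := mem_vset.1 h
  exact Finset.card_pos.2 ⟨p, by simp [hp]⟩

lemma mem_vset_of_mult {A : Finset (Pts k)} {i : Fin n} (h : 1 ≤ mult A i) : i ∈ vset A := by
  obtain ⟨p, hp⟩ := Finset.card_pos.1 h
  simp only [Finset.mem_filter] at hp
  exact mem_vset.2 ⟨p, hp⟩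

lemma ok_of_card {A : Finset (Pts k)} (h : A.card ≤ (vset A).card + 1) :
    (∀ i, mult A i ≤ 2) ∧ ∀ i j, mult A i = 2 → mult A j = 2 → i = j := by
  have hs := sum_mult A
  constructor
  · intro i
    by_contra hi
    have hi' : i ∈ vset A := mem_vset_of_mult (by omega)
    rw [← Finset.add_sum_erase _ _ hi'] at hs
    have : ((vset A).erase i).card • 1 ≤ ∑ j ∈ (vset A).erase i, mult A j :=
      Finset.card_nsmul_le_sum _ _ _ (fun j hj => mult_pos (Finset.mem_of_mem_erase hj))
    have h2 := Finset.card_erase_add_one hi'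
    simp only [smul_eq_mul, mul_one] at this
    omega
  · intro i j hi hj
    by_contra hne
    have hi' : i ∈ vset A := mem_vset_of_mult (by omega)
    have hj' : j ∈ (vset A).erase i :=
      Finset.mem_erase.2 ⟨Ne.symm hne, mem_vset_of_mult (by omega)⟩
    rw [← Finset.add_sum_erase _ _ hi', ← Finset.add_sum_erase _ _ hj'] at hs
    have : (((vset A).erase i).erase j).card • 1 ≤ ∑ l ∈ ((vset A).erase i).erase j, mult A l :=
      Finset.card_nsmul_le_sum _ _ _
        (fun l hl => mult_pos (Finset.mem_of_mem_erase (Finset.mem_of_mem_erase hl)))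
    have h2 := Finset.card_erase_add_one hi'
    have h3 := Finset.card_erase_add_one hj'
    simp only [smul_eq_mul, mul_one] at this
    omega

lemma card_of_ok {A : Finset (Pts k)} (h1 : ∀ i, mult A i ≤ 2)
    (h2 : ∀ i j, mult A i = 2 → mult A j = 2 → i = j) : A.card ≤ (vset A).card + 1 := by
  have hs := sum_mult A
  by_cases h : ∃ i, mult A i = 2
  · obtain ⟨i, hi⟩ := h
    have hi' : i ∈ vset A := mem_vset_of_mult (by omega)
    rw [← Finset.add_sum_erase _ _ hi'] at hs
    have : ∑ j ∈ (vset A).erase i, mult A j ≤ ((vset A).erase i).card • 1 := by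
      apply Finset.sum_le_card_nsmul
      intro j hj
      by_contra hc
      have := h1 j
      exact (Finset.mem_erase.1 hj).1 (h2 j i (by omega) hi)
    have h3 := Finset.card_erase_add_one hi'
    simp only [smul_eq_mul, mul_one] at this
    omega
  · push Not at h
    have : ∑ j ∈ vset A, mult A j ≤ (vset A).card • 1 := by
      apply Finset.sum_le_card_nsmul
      intro j hj
      have := h1 j
      have := h j
      omega
    simp only [smul_eq_mul, mul_one] at this
    omega

lemma vset_image_subset (σ : Equiv.Perm (Pts k)) (A D : Finset (Pts k))
    (hfix : ∀ p ∈ A, p ∉ D → σ p = p) : vset (A.image σ) ⊆ vset A ∪ vset (D.image σ) := by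
  intro i hi
  obtain ⟨q, hq, rfl⟩ := mem_vset.1 hi
  obtain ⟨p, hp, rfl⟩ := Finset.mem_image.1 hq
  by_cases h : p ∈ D
  · exact Finset.mem_union_right _ (fst_mem_vset (Finset.mem_image_of_mem _ h))
  · rw [hfix p hp h]
    exact Finset.mem_union_left _ (fst_mem_vset hp)

lemma subset_vset_image (σ : Equiv.Perm (Pts k)) (A D : Finset (Pts k)) (hD : D ⊆ A)
    (hfix : ∀ p ∈ A, p ∉ D → σ p = p) :
    (vset A \ vset D) ∪ vset (D.image σ) ⊆ vset (A.image σ) := by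
  intro i hi
  rcases Finset.mem_union.1 hi with h | h
  · obtain ⟨h1, h2⟩ := Finset.mem_sdiff.1 h
    obtain ⟨p, hp, rfl⟩ := mem_vset.1 h1
    have hpD : p ∉ D := fun h => h2 (fst_mem_vset h)
    have := fst_mem_vset (Finset.mem_image_of_mem σ hp)
    rwa [hfix p hp hpD] at this
  · exact Finset.image_subset_image (Finset.image_subset_image hD) h

lemma image_eq_self (σ : Equiv.Perm (Pts k)) (A : Finset (Pts k))
    (hfix : ∀ p ∈ A, σ p = p) : A.image σ = A := by
  ext q
  simp only [Finset.mem_image]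
  constructor
  · rintro ⟨p, hp, rfl⟩
    rwa [hfix p hp]
  · intro h
    exact ⟨q, h, hfix q h⟩

/-- Condition (iii) is preserved. -/
lemma inter_core {Q : Finset (Finset (Pts k))}
    (h3 : ∀ U ∈ Q, ∀ W ∈ Q, U ≠ W → (vset U ∩ vset W).card ≤ 2)
    {U W₁ W₂ : Finset (Pts k)} (hU : U ∈ Q) (hW₁ : W₁ ∈ Q) (hW₂ : W₂ ∈ Q)
    (hn₁ : ¬ Near Q U W₁) (hn₂ : ¬ Near Q U W₂)
    (σ : Equiv.Perm (Pts k))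
    (hfix : ∀ A ∈ Q, A ≠ U → A ≠ W₁ → A ≠ W₂ → A.image σ = A)
    (S T₁ T₂ : Finset (Fin n))
    (hS : S ⊆ vset W₁ ∪ vset W₂) (hT₁ : T₁ ⊆ vset U) (hT₂ : T₂ ⊆ vset U)
    (cS : S.card ≤ 2) (cT₁ : T₁.card ≤ 2) (cT₂ : T₂.card ≤ 2)
    (c₁ : ((S ∩ vset W₁) ∪ T₁).card ≤ 2) (c₂ : ((S ∩ vset W₂) ∪ T₂).card ≤ 2)
    (c₃ : W₁ ≠ W₂ → ((vset W₁ ∩ vset W₂) ∪ (T₁ ∩ T₂)).card ≤ 2)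
    (eU : vset (U.image σ) ⊆ vset U ∪ S) (e₁ : vset (W₁.image σ) ⊆ vset W₁ ∪ T₁)
    (e₂ : vset (W₂.image σ) ⊆ vset W₂ ∪ T₂) :
    ∀ A ∈ img σ Q, ∀ B ∈ img σ Q, A ≠ B → (vset A ∩ vset B).card ≤ 2 := by
  -- no part meets both
  have nn₁ : ∀ e ∈ Q, ∀ i ∈ vset e, ∀ j ∈ vset e, i ∈ vset U → j ∈ vset W₁ → False := by
    intro e he i hi j hj hiU hj1
    exact hn₁ ⟨e, he, Finset.not_disjoint_iff.2 ⟨i, hi, hiU⟩, Finset.not_disjoint_iff.2 ⟨j, hj, hj1⟩⟩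
  have nn₂ : ∀ e ∈ Q, ∀ i ∈ vset e, ∀ j ∈ vset e, i ∈ vset U → j ∈ vset W₂ → False := by
    intro e he i hi j hj hiU hj1
    exact hn₂ ⟨e, he, Finset.not_disjoint_iff.2 ⟨i, hi, hiU⟩, Finset.not_disjoint_iff.2 ⟨j, hj, hj1⟩⟩
  have d₁ : ∀ i, i ∈ vset U → i ∈ vset W₁ → False := fun i hi hj => nn₁ U hU i hi i hi hi hj
  have d₂ : ∀ i, i ∈ vset U → i ∈ vset W₂ → False := fun i hi hj => nn₂ U hU i hi i hi hi hj
  -- other part against U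
  have fU : ∀ e ∈ Q, e ≠ U → (vset e ∩ vset (U.image σ)).card ≤ 2 := by
    intro e he hne
    by_cases hh : ∃ i ∈ vset e, i ∈ vset U
    · obtain ⟨i, hi, hiU⟩ := hh
      refine (Finset.card_le_card ?_).trans (h3 e he U hU hne)
      intro j hj
      obtain ⟨hj1, hj2⟩ := Finset.mem_inter.1 hj
      refine Finset.mem_inter.2 ⟨hj1, ?_⟩
      rcases Finset.mem_union.1 (eU hj2) with h | h
      · exact h
      · rcases Finset.mem_union.1 (hS h) with h | h
        · exact (nn₁ e he i hi j hj1 hiU h).elim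
        · exact (nn₂ e he i hi j hj1 hiU h).elim
    · refine (Finset.card_le_card ?_).trans cS
      intro j hj
      obtain ⟨hj1, hj2⟩ := Finset.mem_inter.1 hj
      rcases Finset.mem_union.1 (eU hj2) with h | h
      · exact (hh ⟨j, hj1, h⟩).elim
      · exact h
  have fW : ∀ W ∈ Q, ∀ T ⊆ vset U, T.card ≤ 2 → vset (W.image σ) ⊆ vset W ∪ T →
      (∀ e ∈ Q, ∀ i ∈ vset e, ∀ j ∈ vset e, i ∈ vset U → j ∈ vset W → False) →
      ∀ e ∈ Q, e ≠ W → (vset e ∩ vset (W.image σ)).card ≤ 2 := by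
    intro W hW T hT cT eW nn e he hne
    by_cases hh : ∃ i ∈ vset e, i ∈ T
    · obtain ⟨i, hi, hiU⟩ := hh
      refine (Finset.card_le_card ?_).trans cT
      intro j hj
      obtain ⟨hj1, hj2⟩ := Finset.mem_inter.1 hj
      rcases Finset.mem_union.1 (eW hj2) with h | h
      · exact (nn e he i hi j hj1 (hT hiU) h).elim
      · exact h
    · refine (Finset.card_le_card ?_).trans (h3 e he W hW hne)
      intro j hj
      obtain ⟨hj1, hj2⟩ := Finset.mem_inter.1 hj
      refine Finset.mem_inter.2 ⟨hj1, ?_⟩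
      rcases Finset.mem_union.1 (eW hj2) with h | h
      · exact h
      · exact (hh ⟨j, hj1, h⟩).elim
  have fUW : ∀ W ∈ Q, ∀ T ⊆ vset U, ((S ∩ vset W) ∪ T).card ≤ 2 →
      vset (W.image σ) ⊆ vset W ∪ T → (∀ i, i ∈ vset U → i ∈ vset W → False) →
      (vset (U.image σ) ∩ vset (W.image σ)).card ≤ 2 := by
    intro W hW T hT c eW d
    refine (Finset.card_le_card ?_).trans c
    intro j hj
    obtain ⟨hj1, hj2⟩ := Finset.mem_inter.1 hj
    rcases Finset.mem_union.1 (eW hj2) with h | h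
    · rcases Finset.mem_union.1 (eU hj1) with h' | h'
      · exact (d j h' h).elim
      · exact Finset.mem_union_left _ (Finset.mem_inter.2 ⟨h', h⟩)
    · exact Finset.mem_union_right _ h
  have f12 : W₁ ≠ W₂ → (vset (W₁.image σ) ∩ vset (W₂.image σ)).card ≤ 2 := by
    intro hne
    refine (Finset.card_le_card ?_).trans (c₃ hne)
    intro j hj
    obtain ⟨hj1, hj2⟩ := Finset.mem_inter.1 hj
    rcases Finset.mem_union.1 (e₁ hj1) with h | h <;>
    rcases Finset.mem_union.1 (e₂ hj2) with h' | h'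
    · exact Finset.mem_union_left _ (Finset.mem_inter.2 ⟨h, h'⟩)
    · exact (d₁ j (hT₂ h') h).elim
    · exact (d₂ j (hT₁ h) h').elim
    · exact Finset.mem_union_right _ (Finset.mem_inter.2 ⟨h, h'⟩)
  have g₁ := fW W₁ hW₁ T₁ hT₁ cT₁ e₁ nn₁
  have g₂ := fW W₂ hW₂ T₂ hT₂ cT₂ e₂ nn₂
  have gU₁ := fUW W₁ hW₁ T₁ hT₁ c₁ e₁ d₁
  have gU₂ := fUW W₂ hW₂ T₂ hT₂ c₂ e₂ d₂
  -- normalise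
  have main : ∀ A ∈ Q, ∀ B ∈ Q, A ≠ B → (vset (A.image σ) ∩ vset (B.image σ)).card ≤ 2 := by
    intro A hA B hB hAB
    by_cases a0 : A = U
    · subst a0
      by_cases b1 : B = W₁
      · subst b1; exact gU₁
      by_cases b2 : B = W₂
      · subst b2; exact gU₂
      rw [hfix B hB hAB.symm b1 b2, Finset.inter_comm]
      exact fU B hB hAB.symm
    by_cases a1 : A = W₁
    · subst a1
      by_cases b1 : B = U
      · subst b1; rw [Finset.inter_comm]; exact gU₁
      by_cases b2 : B = W₂
      · subst b2; exact f12 hAB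
      rw [hfix B hB b1 hAB.symm b2, Finset.inter_comm]
      exact g₁ B hB hAB.symm
    by_cases a2 : A = W₂
    · subst a2
      by_cases b1 : B = U
      · subst b1; rw [Finset.inter_comm]; exact gU₂
      by_cases b2 : B = W₁
      · subst b2; rw [Finset.inter_comm]; exact f12 hAB.symm
      rw [hfix B hB b1 b2 hAB.symm, Finset.inter_comm]
      exact g₂ B hB hAB.symm
    rw [hfix A hA a0 a1 a2]
    by_cases b0 : B = U
    · subst b0; exact fU A hA hAB
    by_cases b1 : B = W₁
    · subst b1; exact g₁ A hA hAB
    by_cases b2 : B = W₂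
    · subst b2; exact g₂ A hA hAB
    rw [hfix B hB b0 b1 b2]
    exact h3 A hA B hB hAB
  intro A hA B hB hAB
  obtain ⟨A', hA', rfl⟩ := Finset.mem_image.1 hA
  obtain ⟨B', hB', rfl⟩ := Finset.mem_image.1 hB
  exact main A' hA' B' hB' (fun h => hAB (by rw [h]))

/-- the switching permutation -/
def sw (x₁ x₂ y₁ y₂ : Pts k) : Equiv.Perm (Pts k) := Equiv.swap x₁ y₁ * Equiv.swap x₂ y₂

lemma sw_spec {x₁ x₂ y₁ y₂ : Pts k} (hx : x₁ ≠ x₂) (hy : y₁ ≠ y₂)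
    (h12 : x₁ ≠ y₂) (h21 : x₂ ≠ y₁) :
    sw x₁ x₂ y₁ y₂ x₁ = y₁ ∧ sw x₁ x₂ y₁ y₂ x₂ = y₂ ∧ sw x₁ x₂ y₁ y₂ y₁ = x₁ ∧
    sw x₁ x₂ y₁ y₂ y₂ = x₂ ∧
    ∀ p, p ≠ x₁ → p ≠ x₂ → p ≠ y₁ → p ≠ y₂ → sw x₁ x₂ y₁ y₂ p = p := by
  unfold sw
  refine ⟨?_, ?_, ?_, ?_, ?_⟩
  · simp [Equiv.swap_apply_of_ne_of_ne hx h12]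
  · simp [Equiv.swap_apply_of_ne_of_ne h12.symm hy.symm]
  · simp [Equiv.swap_apply_of_ne_of_ne h21.symm hy]
  · simp [Equiv.swap_apply_of_ne_of_ne hx.symm h21]
  · intro p h1 h2 h3 h4
    simp [Equiv.swap_apply_of_ne_of_ne h1 h3, Equiv.swap_apply_of_ne_of_ne h2 h4]

lemma nloops_img (σ : Equiv.Perm (Pts k)) (Q : Finset (Finset (Pts k))) :
    nloops (img σ Q) = (Q.filter fun U => HasLoop (U.image σ)).card := by
  unfold nloops img
  rw [Finset.filter_image, Finset.card_image_of_injective _ (image_perm_inj σ)]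

lemma vset_pair (σ : Equiv.Perm (Pts k)) (a b : Pts k) :
    vset (Finset.image σ {a, b}) = {(σ a).1, (σ b).1} := by
  ext i
  simp [mem_vset, eq_comm]

lemma vset_sing (σ : Equiv.Perm (Pts k)) (a : Pts k) :
    vset (Finset.image σ {a}) = {(σ a).1} := by
  ext i
  simp [mem_vset, eq_comm]

lemma near_symm {Q : Finset (Finset (Pts k))} {A B : Finset (Pts k)} :
    Near Q A B ↔ Near Q B A := by
  unfold Near
  constructor <;> rintro ⟨e, he, h1, h2⟩ <;> exact ⟨e, he, h2, h1⟩

lemma forward {r ℓ : ℕ} {Q : Finset (Finset (Pts k))} (hQ : Q ∈ Cset r k ℓ) (hℓ : 1 ≤ ℓ)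
    {x₁ x₂ y₁ y₂ : Pts k} (hx : x₁ ≠ x₂) (hxc : x₁.1 = x₂.1) (hxp : pt Q x₁ = pt Q x₂)
    (hl₁ : ¬ HasLoop (pt Q y₁)) (hl₂ : ¬ HasLoop (pt Q y₂))
    (hn₁ : ¬ Near Q (pt Q x₁) (pt Q y₁)) (hn₂ : ¬ Near Q (pt Q x₁) (pt Q y₂))
    (hd : Disjoint (vset (pt Q y₁)) (vset (pt Q y₂))) :
    img (sw x₁ x₂ y₁ y₂) Q ∈ Cset r k (ℓ - 1) ∧ y₁ ≠ y₂ ∧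
      pt (img (sw x₁ x₂ y₁ y₂) Q) y₁ = pt (img (sw x₁ x₂ y₁ y₂) Q) y₂ := by
  obtain ⟨⟨hP, hi, hii, hiii, hiv⟩, hnl⟩ := hQ
  obtain ⟨hU, mx₁⟩ := pt_spec hP x₁
  obtain ⟨hW₁, my₁⟩ := pt_spec hP y₁
  obtain ⟨hW₂, my₂⟩ := pt_spec hP y₂
  have mx₂ : x₂ ∈ pt Q x₁ := hxp ▸ (pt_spec hP x₂).2
  have uniq : ∀ A ∈ Q, ∀ p ∈ A, pt Q p = A := fun A hA p hp => pt_eq hP hA hp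
  generalize hUe : pt Q x₁ = U at *
  generalize hW₁e : pt Q y₁ = W₁ at *
  generalize hW₂e : pt Q y₂ = W₂ at *
  have hx₂e : pt Q x₂ = U := hxp.symm
  have vx₁ := fst_mem_vset mx₁
  have vy₁ := fst_mem_vset my₁
  have vy₂ := fst_mem_vset my₂
  have d₁ : Disjoint (vset U) (vset W₁) := by
    by_contra h
    refine hn₁ ⟨U, hU, ?_, h⟩
    exact Finset.not_disjoint_iff.2 ⟨_, vx₁, vx₁⟩
  have d₂ : Disjoint (vset U) (vset W₂) := by
    by_contra h
    refine hn₂ ⟨U, hU, ?_, h⟩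
    exact Finset.not_disjoint_iff.2 ⟨_, vx₁, vx₁⟩
  rw [Finset.disjoint_left] at d₁ d₂ hd
  have a12 : y₁.1 ≠ y₂.1 := fun h => hd vy₁ (h ▸ vy₂)
  have hy : y₁ ≠ y₂ := fun h => a12 (by rw [h])
  have v1 : x₁.1 ≠ y₁.1 := fun h => d₁ vx₁ (h ▸ vy₁)
  have v2 : x₁.1 ≠ y₂.1 := fun h => d₂ vx₁ (h ▸ vy₂)
  have hUW₁ : U ≠ W₁ := by rintro rfl; exact d₁ vx₁ vx₁
  have hUW₂ : U ≠ W₂ := by rintro rfl; exact d₂ vx₁ vx₁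
  have hWW : W₁ ≠ W₂ := by rintro rfl; exact hd vy₁ vy₁
  obtain ⟨s1, s2, s3, s4, s5⟩ := sw_spec hx hy (fun h => v2 (by rw [h]))
    (fun h => v1 (by rw [hxc, h]))
  generalize hσ : sw x₁ x₂ y₁ y₂ = σ at *
  have hP' := isPartition_img hP σ
  have np : ∀ {p q : Pts k} {A B : Finset (Pts k)}, pt Q p = A → pt Q q = B → A ≠ B → p ≠ q := by
    intro p q A B h1 h2 h3 h4
    exact h3 (by rw [← h1, ← h2, h4])
  have fixA : ∀ A ∈ Q, A ≠ U → A ≠ W₁ → A ≠ W₂ → A.image σ = A := by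
    intro A hA h1 h2 h3
    apply image_eq_self
    intro p hp
    have := uniq A hA p hp
    exact s5 p (np this hUe h1) (np this hx₂e h1) (np this hW₁e h2) (np this hW₂e h3)
  have fixU : ∀ p ∈ U, p ∉ ({x₁, x₂} : Finset (Pts k)) → σ p = p := by
    intro p hp hpn
    have := uniq U hU p hp
    simp only [Finset.mem_insert, Finset.mem_singleton, not_or] at hpn
    exact s5 p hpn.1 hpn.2 (np this hW₁e hUW₁) (np this hW₂e hUW₂)
  have fixW₁ : ∀ p ∈ W₁, p ∉ ({y₁} : Finset (Pts k)) → σ p = p := by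
    intro p hp hpn
    have := uniq W₁ hW₁ p hp
    simp only [Finset.mem_singleton] at hpn
    exact s5 p (np this hUe hUW₁.symm) (np this hx₂e hUW₁.symm) hpn (np this hW₂e hWW)
  have fixW₂ : ∀ p ∈ W₂, p ∉ ({y₂} : Finset (Pts k)) → σ p = p := by
    intro p hp hpn
    have := uniq W₂ hW₂ p hp
    simp only [Finset.mem_singleton] at hpn
    exact s5 p (np this hUe hUW₂.symm) (np this hx₂e hUW₂.symm) (np this hW₁e hWW.symm) hpn
  have vi := vset_pair (k := k) 1 x₁ x₂
  have vi₁ := vset_sing (k := k) 1 y₁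
  have vi₂ := vset_sing (k := k) 1 y₂
  simp only [Equiv.Perm.coe_one, Finset.image_id, id_eq] at vi vi₁ vi₂
  have eU := vset_image_subset σ U {x₁, x₂} fixU
  have e₁ := vset_image_subset σ W₁ {y₁} fixW₁
  have e₂ := vset_image_subset σ W₂ {y₂} fixW₂
  have gU := subset_vset_image σ U {x₁, x₂} (by simp [Finset.insert_subset_iff, mx₁, mx₂]) fixU
  have g₁ := subset_vset_image σ W₁ {y₁} (by simp [my₁]) fixW₁
  have g₂ := subset_vset_image σ W₂ {y₂} (by simp [my₂]) fixW₂
  rw [vset_pair, s1, s2] at eU gU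
  rw [vset_sing] at e₁ e₂ g₁ g₂
  rw [s3] at e₁ g₁
  rw [s4, ← hxc] at e₂ g₂
  rw [vi, ← hxc, Finset.pair_eq_singleton] at gU
  rw [vi₁] at g₁
  rw [vi₂] at g₂
  have cU : U.card ≤ (vset U).card + 1 := card_of_ok (hi U hU) (hii U hU)
  have cimg : ∀ A : Finset (Pts k), (A.image σ).card = A.card :=
    fun A => Finset.card_image_of_injective _ σ.injective
  have nU : ¬ HasLoop (U.image σ) := by
    rw [not_hasLoop_iff, cimg]
    refine le_trans ?_ (Finset.card_le_card gU)
    rw [Finset.card_union_of_disjoint, Finset.card_sdiff_of_subset (by simpa using vx₁),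
      Finset.card_pair a12, Finset.card_singleton]
    · have := Finset.card_pos.2 ⟨_, vx₁⟩
      omega
    · rw [Finset.disjoint_right]
      intro i hi
      simp only [Finset.mem_insert, Finset.mem_singleton] at hi
      rcases hi with rfl | rfl
      · exact fun h => d₁ (Finset.mem_sdiff.1 h).1 vy₁
      · exact fun h => d₂ (Finset.mem_sdiff.1 h).1 vy₂
  have nW₁ : ¬ HasLoop (W₁.image σ) := by
    rw [not_hasLoop_iff, cimg]
    refine le_trans ?_ (Finset.card_le_card g₁)
    rw [Finset.card_union_of_disjoint, Finset.card_sdiff_of_subset (by simpa using vy₁),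
      Finset.card_singleton, Finset.card_singleton]
    · have := not_hasLoop_iff.1 hl₁
      omega
    · rw [Finset.disjoint_singleton_right]
      exact fun h => d₁ vx₁ (Finset.mem_sdiff.1 h).1
  have nW₂ : ¬ HasLoop (W₂.image σ) := by
    rw [not_hasLoop_iff, cimg]
    refine le_trans ?_ (Finset.card_le_card g₂)
    rw [Finset.card_union_of_disjoint, Finset.card_sdiff_of_subset (by simpa using vy₂),
      Finset.card_singleton, Finset.card_singleton]
    · have := not_hasLoop_iff.1 hl₂
      omega
    · rw [Finset.disjoint_singleton_right]
      exact fun h => d₂ vx₁ (Finset.mem_sdiff.1 h).1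
  have lU : HasLoop U := ⟨x₁, mx₁, x₂, mx₂, hx, hxc⟩
  have hcount : nloops (img σ Q) = ℓ - 1 := by
    rw [nloops_img, ← hnl]
    unfold nloops
    rw [← Finset.card_erase_of_mem (Finset.mem_filter.2 ⟨hU, lU⟩)]
    congr 1
    ext A
    simp only [Finset.mem_filter, Finset.mem_erase]
    by_cases h0 : A = U
    · subst h0; simp [nU]
    by_cases h1 : A = W₁
    · subst h1; simp [nW₁, hl₁]
    by_cases h2 : A = W₂
    · subst h2; simp [nW₂, hl₂]
    constructor
    · rintro ⟨hA, h⟩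
      rw [fixA A hA h0 h1 h2] at h
      exact ⟨h0, hA, h⟩
    · rintro ⟨-, hA, h⟩
      rw [fixA A hA h0 h1 h2]
      exact ⟨hA, h⟩
  have hok : ∀ A ∈ img σ Q, A.card ≤ (vset A).card + 1 := by
    intro A hA
    obtain ⟨B, hB, rfl⟩ := Finset.mem_image.1 hA
    by_cases h0 : B = U
    · subst h0; exact (not_hasLoop_iff.1 nU).trans (Nat.le_succ _)
    by_cases h1 : B = W₁
    · subst h1; exact (not_hasLoop_iff.1 nW₁).trans (Nat.le_succ _)
    by_cases h2 : B = W₂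
    · subst h2; exact (not_hasLoop_iff.1 nW₂).trans (Nat.le_succ _)
    simp only [fixA B hB h0 h1 h2]
    exact card_of_ok (hi B hB) (hii B hB)
  have hinter := inter_core hiii hU hW₁ hW₂ hn₁ hn₂ σ fixA {y₁.1, y₂.1} {x₁.1} {x₁.1}
    (by
      intro i hi
      simp only [Finset.mem_insert, Finset.mem_singleton] at hi
      rcases hi with rfl | rfl
      · exact Finset.mem_union_left _ vy₁
      · exact Finset.mem_union_right _ vy₂)
    (by simpa using vx₁) (by simpa using vx₁) Finset.card_le_two (by simp) (by simp)
    (by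
      refine (Finset.card_le_card (t := {y₁.1, x₁.1}) ?_).trans Finset.card_le_two
      intro i hi
      simp only [Finset.mem_union, Finset.mem_inter, Finset.mem_insert, Finset.mem_singleton] at hi ⊢
      rcases hi with ⟨rfl | rfl, h⟩ | rfl
      · simp
      · exact (hd h vy₂).elim
      · simp)
    (by
      refine (Finset.card_le_card (t := {y₂.1, x₁.1}) ?_).trans Finset.card_le_two
      intro i hi
      simp only [Finset.mem_union, Finset.mem_inter, Finset.mem_insert, Finset.mem_singleton] at hi ⊢
      rcases hi with ⟨rfl | rfl, h⟩ | rfl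
      · exact (hd vy₁ h).elim
      · simp
      · simp)
    (by
      intro _
      rw [Finset.disjoint_iff_inter_eq_empty.1 (Finset.disjoint_left.2 hd)]
      simp)
    eU e₁ e₂
  refine ⟨⟨⟨hP', fun A hA => (ok_of_card (hok A hA)).1, fun A hA => (ok_of_card (hok A hA)).2,
    hinter, ?_⟩, hcount⟩, hy, ?_⟩
  · rw [hcount]; omega
  · rw [pt_eq hP' (mem_img_of_mem σ hU) (Finset.mem_image.2 ⟨x₁, mx₁, s1⟩),
      pt_eq hP' (mem_img_of_mem σ hU) (Finset.mem_image.2 ⟨x₂, mx₂, s2⟩)]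

lemma reverse {r ℓ : ℕ} {Q : Finset (Finset (Pts k))} (hQ : Q ∈ Cset r k (ℓ - 1)) (hℓ : 1 ≤ ℓ)
    (hN : ℓ ≤ Nbound r k)
    {x₁ x₂ y₁ y₂ : Pts k} (hx : x₁ ≠ x₂) (hxc : x₁.1 = x₂.1)
    (hl₁ : ¬ HasLoop (pt Q x₁)) (hl₂ : ¬ HasLoop (pt Q x₂))
    (hy : y₁ ≠ y₂) (hyp : pt Q y₁ = pt Q y₂) (hl : ¬ HasLoop (pt Q y₁))
    (hn₁ : ¬ Near Q (pt Q x₁) (pt Q y₁)) (hn₂ : ¬ Near Q (pt Q x₂) (pt Q y₁)) :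
    img (sw x₁ x₂ y₁ y₂) Q ∈ Cset r k ℓ ∧
      pt (img (sw x₁ x₂ y₁ y₂) Q) x₁ = pt (img (sw x₁ x₂ y₁ y₂) Q) x₂ := by
  obtain ⟨⟨hP, hi, hii, hiii, hiv⟩, hnl⟩ := hQ
  obtain ⟨hU, my₁⟩ := pt_spec hP y₁
  obtain ⟨hW₁, mx₁⟩ := pt_spec hP x₁
  obtain ⟨hW₂, mx₂⟩ := pt_spec hP x₂
  have my₂ : y₂ ∈ pt Q y₁ := hyp ▸ (pt_spec hP y₂).2
  have uniq : ∀ A ∈ Q, ∀ p ∈ A, pt Q p = A := fun A hA p hp => pt_eq hP hA hp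
  rw [near_symm] at hn₁ hn₂
  generalize hUe : pt Q y₁ = U at *
  generalize hW₁e : pt Q x₁ = W₁ at *
  generalize hW₂e : pt Q x₂ = W₂ at *
  have hy₂e : pt Q y₂ = U := hyp.symm
  have vx₁ := fst_mem_vset mx₁
  have vx₂ := fst_mem_vset mx₂
  rw [← hxc] at vx₂
  have vy₁ := fst_mem_vset my₁
  have vy₂ := fst_mem_vset my₂
  have d₁ : Disjoint (vset U) (vset W₁) := by
    by_contra h
    refine hn₁ ⟨U, hU, ?_, h⟩
    exact Finset.not_disjoint_iff.2 ⟨_, vy₁, vy₁⟩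
  have d₂ : Disjoint (vset U) (vset W₂) := by
    by_contra h
    refine hn₂ ⟨U, hU, ?_, h⟩
    exact Finset.not_disjoint_iff.2 ⟨_, vy₁, vy₁⟩
  rw [Finset.disjoint_left] at d₁ d₂
  have a12 : y₁.1 ≠ y₂.1 := fun h => hl ⟨y₁, my₁, y₂, my₂, hy, h⟩
  have v1 : x₁.1 ≠ y₁.1 := fun h => d₁ vy₁ (h ▸ vx₁)
  have v2 : x₁.1 ≠ y₂.1 := fun h => d₁ vy₂ (h ▸ vx₁)
  have hUW₁ : U ≠ W₁ := by rintro rfl; exact d₁ vx₁ vx₁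
  have hUW₂ : U ≠ W₂ := by rintro rfl; exact d₂ vx₂ vx₂
  have hWW : W₁ ≠ W₂ := by rintro rfl; exact hl₁ ⟨x₁, mx₁, x₂, mx₂, hx, hxc⟩
  obtain ⟨s1, s2, s3, s4, s5⟩ := sw_spec hx hy (fun h => v2 (by rw [h]))
    (fun h => v1 (by rw [hxc, h]))
  generalize hσ : sw x₁ x₂ y₁ y₂ = σ at *
  have hP' := isPartition_img hP σ
  have np : ∀ {p q : Pts k} {A B : Finset (Pts k)}, pt Q p = A → pt Q q = B → A ≠ B → p ≠ q := by
    intro p q A B h1 h2 h3 h4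
    exact h3 (by rw [← h1, ← h2, h4])
  have fixA : ∀ A ∈ Q, A ≠ U → A ≠ W₁ → A ≠ W₂ → A.image σ = A := by
    intro A hA h1 h2 h3
    apply image_eq_self
    intro p hp
    have := uniq A hA p hp
    exact s5 p (np this hW₁e h2) (np this hW₂e h3) (np this hUe h1) (np this hy₂e h1)
  have fixU : ∀ p ∈ U, p ∉ ({y₁, y₂} : Finset (Pts k)) → σ p = p := by
    intro p hp hpn
    have := uniq U hU p hp
    simp only [Finset.mem_insert, Finset.mem_singleton, not_or] at hpn
    exact s5 p (np this hW₁e hUW₁) (np this hW₂e hUW₂) hpn.1 hpn.2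
  have fixW₁ : ∀ p ∈ W₁, p ∉ ({x₁} : Finset (Pts k)) → σ p = p := by
    intro p hp hpn
    have := uniq W₁ hW₁ p hp
    simp only [Finset.mem_singleton] at hpn
    exact s5 p hpn (np this hW₂e hWW) (np this hUe hUW₁.symm) (np this hy₂e hUW₁.symm)
  have fixW₂ : ∀ p ∈ W₂, p ∉ ({x₂} : Finset (Pts k)) → σ p = p := by
    intro p hp hpn
    have := uniq W₂ hW₂ p hp
    simp only [Finset.mem_singleton] at hpn
    exact s5 p (np this hW₁e hWW.symm) hpn (np this hUe hUW₂.symm) (np this hy₂e hUW₂.symm)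
  have vi := vset_pair (k := k) 1 y₁ y₂
  have vi₁ := vset_sing (k := k) 1 x₁
  have vi₂ := vset_sing (k := k) 1 x₂
  simp only [Equiv.Perm.coe_one, Finset.image_id, id_eq] at vi vi₁ vi₂
  have eU := vset_image_subset σ U {y₁, y₂} fixU
  have e₁ := vset_image_subset σ W₁ {x₁} fixW₁
  have e₂ := vset_image_subset σ W₂ {x₂} fixW₂
  have gU := subset_vset_image σ U {y₁, y₂} (by simp [Finset.insert_subset_iff, my₁, my₂]) fixU
  have g₁ := subset_vset_image σ W₁ {x₁} (by simp [mx₁]) fixW₁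
  have g₂ := subset_vset_image σ W₂ {x₂} (by simp [mx₂]) fixW₂
  rw [vset_pair, s3, s4, ← hxc, Finset.pair_eq_singleton] at eU gU
  rw [vset_sing] at e₁ e₂ g₁ g₂
  rw [s1] at e₁ g₁
  rw [s2] at e₂ g₂
  rw [vi] at gU
  rw [vi₁] at g₁
  rw [vi₂, ← hxc] at g₂
  have cimg : ∀ A : Finset (Pts k), (A.image σ).card = A.card :=
    fun A => Finset.card_image_of_injective _ σ.injective
  have okU : (U.image σ).card ≤ (vset (U.image σ)).card + 1 := by
    rw [cimg]
    have h2 := Finset.card_le_card gU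
    rw [Finset.card_union_of_disjoint, Finset.card_sdiff_of_subset
      (by simp [Finset.insert_subset_iff, vy₁, vy₂]),
      Finset.card_pair a12, Finset.card_singleton] at h2
    · have := not_hasLoop_iff.1 hl
      omega
    · rw [Finset.disjoint_singleton_right]
      exact fun h => d₁ (Finset.mem_sdiff.1 h).1 vx₁
  have lU : HasLoop (U.image σ) :=
    ⟨x₁, Finset.mem_image.2 ⟨y₁, my₁, s3⟩, x₂, Finset.mem_image.2 ⟨y₂, my₂, s4⟩, hx, hxc⟩
  have nW₁ : ¬ HasLoop (W₁.image σ) := by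
    rw [not_hasLoop_iff, cimg]
    refine le_trans ?_ (Finset.card_le_card g₁)
    rw [Finset.card_union_of_disjoint, Finset.card_sdiff_of_subset (by simpa using vx₁),
      Finset.card_singleton, Finset.card_singleton]
    · have := not_hasLoop_iff.1 hl₁
      omega
    · rw [Finset.disjoint_singleton_right]
      exact fun h => d₁ vy₁ (Finset.mem_sdiff.1 h).1
  have nW₂ : ¬ HasLoop (W₂.image σ) := by
    rw [not_hasLoop_iff, cimg]
    refine le_trans ?_ (Finset.card_le_card g₂)
    rw [Finset.card_union_of_disjoint, Finset.card_sdiff_of_subset (by simpa using vx₂),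
      Finset.card_singleton, Finset.card_singleton]
    · have := not_hasLoop_iff.1 hl₂
      omega
    · rw [Finset.disjoint_singleton_right]
      exact fun h => d₂ vy₂ (Finset.mem_sdiff.1 h).1
  have hcount : nloops (img σ Q) = ℓ := by
    have h1 : nloops (img σ Q) = nloops Q + 1 := by
      rw [nloops_img]
      unfold nloops
      rw [← Finset.card_insert_of_notMem (a := U) (by simp [hl])]
      congr 1
      ext A
      simp only [Finset.mem_filter, Finset.mem_insert]
      by_cases h0 : A = U
      · subst h0; simp [lU, hU]
      by_cases h1 : A = W₁
      · subst h1; simp [nW₁, hl₁, h0]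
      by_cases h2 : A = W₂
      · subst h2; simp [nW₂, hl₂, h0]
      constructor
      · rintro ⟨hA, h⟩
        rw [fixA A hA h0 h1 h2] at h
        exact Or.inr ⟨hA, h⟩
      · rintro (h | ⟨hA, h⟩)
        · exact (h0 h).elim
        · rw [fixA A hA h0 h1 h2]
          exact ⟨hA, h⟩
    omega
  have hok : ∀ A ∈ img σ Q, A.card ≤ (vset A).card + 1 := by
    intro A hA
    obtain ⟨B, hB, rfl⟩ := Finset.mem_image.1 hA
    by_cases h0 : B = U
    · subst h0; exact okU
    by_cases h1 : B = W₁
    · subst h1; exact (not_hasLoop_iff.1 nW₁).trans (Nat.le_succ _)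
    by_cases h2 : B = W₂
    · subst h2; exact (not_hasLoop_iff.1 nW₂).trans (Nat.le_succ _)
    simp only [fixA B hB h0 h1 h2]
    exact card_of_ok (hi B hB) (hii B hB)
  have hinter := inter_core hiii hU hW₁ hW₂ hn₁ hn₂ σ fixA {x₁.1} {y₁.1} {y₂.1}
    (by simpa using Or.inl vx₁)
    (by simpa using vy₁) (by simpa using vy₂) (by simp) (by simp) (by simp)
    (by
      refine (Finset.card_le_card (t := {x₁.1, y₁.1}) ?_).trans Finset.card_le_two
      intro i hi
      simp only [Finset.mem_union, Finset.mem_inter, Finset.mem_insert, Finset.mem_singleton] at hi ⊢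
      tauto)
    (by
      refine (Finset.card_le_card (t := {x₁.1, y₂.1}) ?_).trans Finset.card_le_two
      intro i hi
      simp only [Finset.mem_union, Finset.mem_inter, Finset.mem_insert, Finset.mem_singleton] at hi ⊢
      tauto)
    (by
      intro h
      have : ({y₁.1} : Finset (Fin n)) ∩ {y₂.1} = ∅ := by
        exact Finset.singleton_inter_of_notMem (by simpa using a12)
      rw [this, Finset.union_empty]
      exact hiii _ hW₁ _ hW₂ h)
    eU e₁ e₂
  refine ⟨⟨⟨hP', fun A hA => (ok_of_card (hok A hA)).1, fun A hA => (ok_of_card (hok A hA)).2,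
    hinter, ?_⟩, hcount⟩, ?_⟩
  · rw [hcount]; omega
  · rw [pt_eq hP' (mem_img_of_mem σ hU) (Finset.mem_image.2 ⟨y₁, my₁, s3⟩),
      pt_eq hP' (mem_img_of_mem σ hU) (Finset.mem_image.2 ⟨y₂, my₂, s4⟩)]

lemma card_pts : (Finset.univ : Finset (Pts k)).card = Mtot k := by
  simp [Mtot, Fintype.card_sigma]

lemma card_cell (i : Fin n) : (Finset.univ.filter fun p : Pts k => p.1 = i).card = k i := by
  have : (Finset.univ.filter fun p : Pts k => p.1 = i) =
      (Finset.univ : Finset (Fin (k i))).image (fun a => (⟨i, a⟩ : Pts k)) := by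
    ext ⟨j, a⟩
    simp only [Finset.mem_filter, Finset.mem_univ, true_and, Finset.mem_image]
    constructor
    · rintro rfl
      exact ⟨a, rfl⟩
    · rintro ⟨b, hb⟩
      exact (congrArg Sigma.fst hb).symm
  rw [this, Finset.card_image_of_injective _ sigma_mk_injective]
  simp

lemma le_kmax (i : Fin n) : k i ≤ kmax k := Finset.le_sup (Finset.mem_univ i)

lemma card_le_fib {α β γ : Type*} (s : Finset γ) (f : γ → α) (g : γ → β)
    (hinj : ∀ a ∈ s, ∀ b ∈ s, f a = f b → g a = g b → a = b) (B : Finset α) (F : α → Finset β)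
    (c : ℕ) (h1 : ∀ a ∈ s, f a ∈ B) (h2 : ∀ a ∈ s, g a ∈ F (f a)) (h3 : ∀ a ∈ B, (F a).card ≤ c) :
    s.card ≤ B.card * c := by
  have : s.card ≤ (B.sigma F).card := by
    apply Finset.card_le_card_of_injOn (fun a => ⟨f a, g a⟩)
    · intro a ha
      simp only [Finset.coe_sigma, Set.mem_sigma_iff]
      exact ⟨h1 a ha, h2 a ha⟩
    · intro a ha b hb hab
      simp only [Sigma.mk.injEq, heq_eq_eq] at hab
      exact hinj a ha b hb hab.1 hab.2
  refine this.trans ?_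
  rw [Finset.card_sigma]
  simpa using Finset.sum_le_card_nsmul B _ c h3

lemma double_count {X T : Type*} (A B : Finset X) (F G : X → Finset T) (act : T → X → X)
    (hinj : ∀ t, Function.Injective (act t))
    (h : ∀ Q ∈ A, ∀ t ∈ F Q, act t Q ∈ B ∧ t ∈ G (act t Q)) :
    ∑ Q ∈ A, (F Q).card ≤ ∑ Q ∈ B, (G Q).card := by
  rw [← Finset.card_sigma, ← Finset.card_sigma]
  apply Finset.card_le_card_of_injOn (fun q => ⟨act q.2 q.1, q.2⟩)
  · rintro ⟨Q, t⟩ hq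
    simp only [Finset.coe_sigma, Set.mem_sigma_iff] at hq ⊢
    exact h Q hq.1 t hq.2
  · rintro ⟨Q, t⟩ _ ⟨Q', t'⟩ _ hab
    simp only [Sigma.mk.injEq, heq_eq_eq] at hab
    obtain ⟨h1, rfl⟩ := hab
    rw [hinj _ h1]

lemma card_hit {r : ℕ} {Q : Finset (Finset (Pts k))} (hQ : IsPartition r k Q)
    (S : Finset (Fin n)) :
    (Finset.univ.filter fun y : Pts k => ¬ Disjoint (vset (pt Q y)) S).card
      ≤ S.card * (kmax k * r) := by
  have hsub : (Finset.univ.filter fun y : Pts k => ¬ Disjoint (vset (pt Q y)) S) ⊆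
      S.biUnion fun i => (Finset.univ.filter fun p : Pts k => p.1 = i).biUnion (pt Q) := by
    intro y hy
    obtain ⟨i, hi, hiS⟩ := Finset.not_disjoint_iff.1 (Finset.mem_filter.1 hy).2
    obtain ⟨p, hp, rfl⟩ := mem_vset.1 hi
    refine Finset.mem_biUnion.2 ⟨p.1, hiS, Finset.mem_biUnion.2 ⟨p, by simp, ?_⟩⟩
    rw [pt_eq hQ (pt_spec hQ y).1 hp]
    exact (pt_spec hQ y).2
  refine (Finset.card_le_card hsub).trans (Finset.card_biUnion_le_card_mul _ _ _ ?_)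
  intro i _
  refine (Finset.card_biUnion_le_card_mul _ _ r ?_).trans ?_
  · intro p _
    exact (hQ.1 _ (pt_spec hQ p).1).le
  · rw [card_cell]
    exact Nat.mul_le_mul_right _ (le_kmax i)

lemma card_near {r : ℕ} {Q : Finset (Finset (Pts k))} (hQ : IsPartition r k Q)
    {A : Finset (Pts k)} (hA : A ∈ Q) :
    (Finset.univ.filter fun y : Pts k => Near Q A (pt Q y)).card
      ≤ r * (kmax k * r) * (kmax k * r) := by
  set S' := vset (Finset.univ.filter fun y : Pts k => ¬ Disjoint (vset (pt Q y)) (vset A))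
  have hsub : (Finset.univ.filter fun y : Pts k => Near Q A (pt Q y)) ⊆
      (Finset.univ.filter fun y : Pts k => ¬ Disjoint (vset (pt Q y)) S') := by
    intro y hy
    obtain ⟨e, he, h1, h2⟩ := (Finset.mem_filter.1 hy).2
    refine Finset.mem_filter.2 ⟨Finset.mem_univ _, ?_⟩
    obtain ⟨i, hi, hiS⟩ := Finset.not_disjoint_iff.1 h2
    refine Finset.not_disjoint_iff.2 ⟨i, hiS, ?_⟩
    obtain ⟨p, hp, rfl⟩ := mem_vset.1 hi
    refine fst_mem_vset (Finset.mem_filter.2 ⟨Finset.mem_univ _, ?_⟩)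
    rwa [pt_eq hQ he hp]
  refine (Finset.card_le_card hsub).trans ((card_hit hQ S').trans ?_)
  refine Nat.mul_le_mul_right _ ?_
  refine (vset_card_le _).trans ((card_hit hQ _).trans (Nat.mul_le_mul_right _ ?_))
  exact (vset_card_le _).trans (hQ.1 A hA).le

lemma card_loopPts {r : ℕ} {Q : Finset (Finset (Pts k))} (hQ : IsPartition r k Q) :
    (Finset.univ.filter fun y : Pts k => HasLoop (pt Q y)).card ≤ nloops Q * r := by
  have hsub : (Finset.univ.filter fun y : Pts k => HasLoop (pt Q y)) ⊆
      (Q.filter fun U => HasLoop U).biUnion id := by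
    intro y hy
    exact Finset.mem_biUnion.2 ⟨pt Q y, Finset.mem_filter.2
      ⟨(pt_spec hQ y).1, (Finset.mem_filter.1 hy).2⟩, (pt_spec hQ y).2⟩
  refine (Finset.card_le_card hsub).trans (Finset.card_biUnion_le_card_mul _ _ _ ?_)
  intro U hU
  exact (hQ.1 U (Finset.mem_filter.1 hU).1).le

/-- ordered pairs of distinct points in the same cell -/
noncomputable def CP (k : Fin n → ℕ) : Finset (Pts k × Pts k) :=
  Finset.univ.filter fun x => x.1 ≠ x.2 ∧ x.1.1 = x.2.1

/-- ordered pairs of distinct points in the same part -/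
noncomputable def PP (Q : Finset (Finset (Pts k))) : Finset (Pts k × Pts k) :=
  Finset.univ.filter fun y => y.1 ≠ y.2 ∧ pt Q y.1 = pt Q y.2

/-- ordered loops -/
noncomputable def LP (Q : Finset (Finset (Pts k))) : Finset (Pts k × Pts k) :=
  Finset.univ.filter fun x => x.1 ≠ x.2 ∧ x.1.1 = x.2.1 ∧ pt Q x.1 = pt Q x.2

lemma card_CP : (CP k).card = M2 k := by
  unfold CP
  rw [Finset.card_filter, Fintype.sum_prod_type]
  have : ∀ x : Pts k, (∑ y : Pts k, if x ≠ y ∧ x.1 = y.1 then 1 else 0) = k x.1 - 1 := by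
    intro x
    rw [← Finset.card_filter]
    have : (Finset.univ.filter fun y : Pts k => x ≠ y ∧ x.1 = y.1) =
        (Finset.univ.filter fun y : Pts k => y.1 = x.1).erase x := by
      ext y
      simp only [Finset.mem_filter, Finset.mem_erase, Finset.mem_univ, true_and, ne_eq]
      rw [eq_comm (a := x), eq_comm (a := x.1)]
    rw [this, Finset.card_erase_of_mem (by simp), card_cell]
  simp only [this]
  rw [Fintype.sum_sigma]
  simp [M2]

lemma card_PP {r : ℕ} {Q : Finset (Finset (Pts k))} (hQ : IsPartition r k Q) :
    (PP Q).card = Mtot k * (r - 1) := by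
  unfold PP
  rw [Finset.card_filter, Fintype.sum_prod_type]
  have : ∀ x : Pts k, (∑ y : Pts k, if x ≠ y ∧ pt Q x = pt Q y then 1 else 0) = r - 1 := by
    intro x
    rw [← Finset.card_filter]
    have : (Finset.univ.filter fun y : Pts k => x ≠ y ∧ pt Q x = pt Q y) =
        (pt Q x).erase x := by
      ext y
      simp only [Finset.mem_filter, Finset.mem_erase, Finset.mem_univ, true_and, ne_eq]
      rw [eq_comm (a := x)]
      refine and_congr_right fun _ => ⟨fun h => h ▸ (pt_spec hQ y).2, fun h => ?_⟩
      rw [pt_eq hQ (pt_spec hQ x).1 h]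
    rw [this, Finset.card_erase_of_mem (pt_spec hQ x).2, hQ.1 _ (pt_spec hQ x).1]
  simp only [this]
  rw [Finset.sum_const, card_pts, smul_eq_mul]

lemma card_LP {r ℓ : ℕ} {Q : Finset (Finset (Pts k))} (hQ : Q ∈ Cset r k ℓ) :
    (LP Q).card = 2 * ℓ := by
  obtain ⟨⟨hP, hi, hii, hiii, hiv⟩, hnl⟩ := hQ
  rw [Finset.card_eq_sum_card_fiberwise (f := fun x => pt Q x.1)
    (t := Q.filter fun U => HasLoop U)]
  · rw [← hnl, mul_comm]
    unfold nloops
    rw [← smul_eq_mul]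
    apply Finset.sum_eq_card_nsmul
    intro U hU
    obtain ⟨hUQ, x, hx, y, hy, hxy, hc⟩ := Finset.mem_filter.1 hU
    have two : ∀ a ∈ U, ∀ b ∈ U, a ≠ b → a.1 = b.1 →
        mult U a.1 = 2 ∧ ({a, b} : Finset (Pts k)) = U.filter fun p => p.1 = a.1 := by
      intro a ha b hb hab hc
      have hs : ({a, b} : Finset (Pts k)) ⊆ U.filter fun p => p.1 = a.1 := by
        simp [Finset.insert_subset_iff, ha, hb, hc]
      have h1 := Finset.card_le_card hs
      have h2 := hi U hUQ a.1
      rw [Finset.card_pair hab] at h1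
      have h3 : mult U a.1 = 2 := le_antisymm h2 h1
      refine ⟨h3, Finset.eq_of_subset_of_card_le hs ?_⟩
      rw [Finset.card_pair hab]
      exact h2
    have : (LP Q).filter (fun z => pt Q z.1 = U) = {(x, y), (y, x)} := by
      ext ⟨a, b⟩
      simp only [LP, Finset.mem_filter, Finset.mem_univ, true_and, Finset.mem_insert,
        Finset.mem_singleton, Prod.mk.injEq]
      constructor
      · rintro ⟨⟨hab, hc', hp⟩, hpU⟩
        have ha : a ∈ U := hpU ▸ (pt_spec hP a).2
        have hb : b ∈ U := hpU ▸ hp ▸ (pt_spec hP b).2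
        obtain ⟨m1, f1⟩ := two a ha b hb hab hc'
        obtain ⟨m2, f2⟩ := two x hx y hy hxy hc
        have e := hii U hUQ _ _ m1 m2
        rw [e, ← f2] at f1
        have ha' : a ∈ ({x, y} : Finset (Pts k)) := f1 ▸ (by simp)
        have hb' : b ∈ ({x, y} : Finset (Pts k)) := f1 ▸ (by simp)
        simp only [Finset.mem_insert, Finset.mem_singleton] at ha' hb'
        rcases ha' with ha' | ha' <;> rcases hb' with hb' | hb'
        · exact (hab (ha'.trans hb'.symm)).elim
        · exact Or.inl ⟨ha', hb'⟩
        · exact Or.inr ⟨ha', hb'⟩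
        · exact (hab (ha'.trans hb'.symm)).elim
      · have ex := pt_eq hP hUQ hx
        have ey := pt_eq hP hUQ hy
        rintro (⟨rfl, rfl⟩ | ⟨rfl, rfl⟩)
        · exact ⟨⟨hxy, hc, by rw [ex, ey]⟩, ex⟩
        · exact ⟨⟨hxy.symm, hc.symm, by rw [ex, ey]⟩, ey⟩
    rw [this, Finset.card_pair]
    intro h
    exact hxy (congrArg Prod.fst h)
  · rintro ⟨a, b⟩ hab
    simp only [LP, Finset.coe_filter, Finset.mem_univ, true_and, Set.mem_ofPred_eq] at hab
    simp only [Finset.coe_filter, Set.mem_ofPred_eq]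
    exact ⟨(pt_spec hP a).1, a, (pt_spec hP a).2, b, hab.2.2 ▸ (pt_spec hP b).2, hab.1, hab.2.1⟩

/-- good forward switchings -/
noncomputable def FG (Q : Finset (Finset (Pts k))) : Finset ((Pts k × Pts k) × (Pts k × Pts k)) :=
  (LP Q ×ˢ Finset.univ).filter fun t =>
    ¬ HasLoop (pt Q t.2.1) ∧ ¬ HasLoop (pt Q t.2.2) ∧ ¬ Near Q (pt Q t.1.1) (pt Q t.2.1) ∧
    ¬ Near Q (pt Q t.1.1) (pt Q t.2.2) ∧ Disjoint (vset (pt Q t.2.1)) (vset (pt Q t.2.2))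

/-- good reverse switchings -/
noncomputable def RG (Q : Finset (Finset (Pts k))) : Finset ((Pts k × Pts k) × (Pts k × Pts k)) :=
  (CP k ×ˢ PP Q).filter fun t =>
    (¬ HasLoop (pt Q t.1.1) ∧ ¬ HasLoop (pt Q t.1.2)) ∧ (¬ HasLoop (pt Q t.2.1) ∧
    ¬ Near Q (pt Q t.1.1) (pt Q t.2.1) ∧ ¬ Near Q (pt Q t.1.2) (pt Q t.2.1))

lemma FG_lower {r ℓ : ℕ} {Q : Finset (Finset (Pts k))} (hQ : Q ∈ Cset r k ℓ) :
    2 * ℓ * (Mtot k * Mtot k) ≤ (FG Q).card + 2 * ℓ *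
      (2 * ((ℓ * r + r * (kmax k * r) * (kmax k * r)) * Mtot k) +
        Mtot k * (r * (kmax k * r))) := by
  have hP : IsPartition r k Q := hQ.1.1
  have h0 : (LP Q ×ˢ (Finset.univ : Finset (Pts k × Pts k))).card
      = 2 * ℓ * (Mtot k * Mtot k) := by
    rw [Finset.card_product, card_LP hQ, ← Finset.univ_product_univ, Finset.card_product, card_pts]
  rw [← h0]
  unfold FG
  rw [← Finset.card_filter_add_card_filter_not (s := LP Q ×ˢ (Finset.univ : Finset (Pts k × Pts k)))
    (fun t => ¬ HasLoop (pt Q t.2.1) ∧ ¬ HasLoop (pt Q t.2.2) ∧ ¬ Near Q (pt Q t.1.1) (pt Q t.2.1) ∧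
    ¬ Near Q (pt Q t.1.1) (pt Q t.2.2) ∧ Disjoint (vset (pt Q t.2.1)) (vset (pt Q t.2.2)))]
  refine Nat.add_le_add_left ?_ _
  rw [← card_LP hQ]
  let B : Pts k → Finset (Pts k) := fun x => (Finset.univ.filter fun y => HasLoop (pt Q y)) ∪
    (Finset.univ.filter fun y => Near Q (pt Q x) (pt Q y))
  let D : Finset (Pts k × Pts k) := Finset.univ.filter fun y =>
    ¬ Disjoint (vset (pt Q y.2)) (vset (pt Q y.1))
  have hB : ∀ x, (B x).card ≤ ℓ * r + r * (kmax k * r) * (kmax k * r) := by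
    intro x
    refine (Finset.card_union_le _ _).trans (Nat.add_le_add ?_ (card_near hP (pt_spec hP x).1))
    have := card_loopPts hP
    rwa [hQ.2] at this
  have hD : D.card ≤ Mtot k * (r * (kmax k * r)) := by
    rw [← card_pts]
    refine card_le_fib D Prod.fst Prod.snd (fun a _ b _ h1 h2 => Prod.ext h1 h2) _
      (fun y1 => Finset.univ.filter fun y : Pts k => ¬ Disjoint (vset (pt Q y)) (vset (pt Q y1)))
      _ (fun _ _ => Finset.mem_univ _) ?_ ?_
    · intro a ha
      exact Finset.mem_filter.2 ⟨Finset.mem_univ _, (Finset.mem_filter.1 ha).2⟩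
    · intro a _
      refine (card_hit hP _).trans (Nat.mul_le_mul_right _ ?_)
      exact (vset_card_le _).trans (hP.1 _ (pt_spec hP a).1).le
  refine card_le_fib _ Prod.fst Prod.snd (fun a _ b _ h1 h2 => Prod.ext h1 h2) (LP Q)
    (fun x => (B x.1 ×ˢ Finset.univ ∪ Finset.univ ×ˢ B x.1) ∪ D) _ ?_ ?_ ?_
  · intro a ha
    exact (Finset.mem_product.1 (Finset.mem_filter.1 ha).1).1
  · intro a ha
    have := (Finset.mem_filter.1 ha).2
    simp only [B, D, Finset.mem_union, Finset.mem_product, Finset.mem_filter, Finset.mem_univ,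
      true_and, and_true]
    rw [disjoint_comm] at this
    tauto
  · intro x _
    refine (Finset.card_union_le _ _).trans (Nat.add_le_add ?_ hD)
    refine (Finset.card_union_le _ _).trans ?_
    rw [Finset.card_product, Finset.card_product, card_pts, mul_comm (Mtot k), ← two_mul]
    exact Nat.mul_le_mul_left _ (Nat.mul_le_mul_right _ (hB x.1))

lemma RG_lower {r ℓ : ℕ} {Q : Finset (Finset (Pts k))} (hQ : Q ∈ Cset r k (ℓ - 1)) :
    M2 k * (Mtot k * (r - 1)) ≤ (RG Q).card + (2 * (ℓ * r * kmax k) * (Mtot k * (r - 1)) +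
      M2 k * ((ℓ * r + 2 * (r * (kmax k * r) * (kmax k * r))) * r)) := by
  have hP : IsPartition r k Q := hQ.1.1
  have h0 : (CP k ×ˢ PP Q).card = M2 k * (Mtot k * (r - 1)) := by
    rw [Finset.card_product, card_CP, card_PP hP]
  have hL : (Finset.univ.filter fun y : Pts k => HasLoop (pt Q y)).card ≤ ℓ * r := by
    refine (card_loopPts hP).trans (Nat.mul_le_mul_right _ ?_)
    rw [hQ.2]; omega
  rw [← h0]
  unfold RG
  rw [← Finset.card_filter_add_card_filter_not (s := CP k ×ˢ PP Q)
    (fun t => (¬ HasLoop (pt Q t.1.1) ∧ ¬ HasLoop (pt Q t.1.2)) ∧ (¬ HasLoop (pt Q t.2.1) ∧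
    ¬ Near Q (pt Q t.1.1) (pt Q t.2.1) ∧ ¬ Near Q (pt Q t.1.2) (pt Q t.2.1)))]
  refine Nat.add_le_add_left ?_ _
  let B : Pts k × Pts k → Finset (Pts k) := fun x =>
    (Finset.univ.filter fun y => HasLoop (pt Q y)) ∪
    ((Finset.univ.filter fun y => Near Q (pt Q x.1) (pt Q y)) ∪
    (Finset.univ.filter fun y => Near Q (pt Q x.2) (pt Q y)))
  have hB : ∀ x, (B x).card ≤ ℓ * r + 2 * (r * (kmax k * r) * (kmax k * r)) := by
    intro x
    refine (Finset.card_union_le _ _).trans (Nat.add_le_add hL ?_)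
    refine (Finset.card_union_le _ _).trans ?_
    have h1 := card_near hP (pt_spec hP x.1).1
    have h2 := card_near hP (pt_spec hP x.2).1
    omega
  let C₁ : Finset (Pts k × Pts k) := (CP k).filter fun x => HasLoop (pt Q x.1)
  let C₂ : Finset (Pts k × Pts k) := (CP k).filter fun x => HasLoop (pt Q x.2)
  let G : Finset ((Pts k × Pts k) × (Pts k × Pts k)) :=
    (CP k ×ˢ PP Q).filter fun t => t.2.1 ∈ B t.1
  have hC₁ : C₁.card ≤ ℓ * r * kmax k := by
    refine (card_le_fib C₁ Prod.fst Prod.snd (fun a _ b _ h1 h2 => Prod.ext h1 h2)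
      (Finset.univ.filter fun y => HasLoop (pt Q y))
      (fun x => Finset.univ.filter fun y : Pts k => y.1 = x.1) (kmax k) ?_ ?_ ?_).trans
      (Nat.mul_le_mul_right _ hL)
    · intro a ha
      exact Finset.mem_filter.2 ⟨Finset.mem_univ _, (Finset.mem_filter.1 ha).2⟩
    · intro a ha
      have := (Finset.mem_filter.1 (Finset.mem_filter.1 ha).1).2
      exact Finset.mem_filter.2 ⟨Finset.mem_univ _, this.2.symm⟩
    · intro a _
      rw [card_cell]
      exact le_kmax _
  have hC₂ : C₂.card ≤ ℓ * r * kmax k := by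
    refine (card_le_fib C₂ Prod.snd Prod.fst (fun a _ b _ h1 h2 => Prod.ext h2 h1)
      (Finset.univ.filter fun y => HasLoop (pt Q y))
      (fun x => Finset.univ.filter fun y : Pts k => y.1 = x.1) (kmax k) ?_ ?_ ?_).trans
      (Nat.mul_le_mul_right _ hL)
    · intro a ha
      exact Finset.mem_filter.2 ⟨Finset.mem_univ _, (Finset.mem_filter.1 ha).2⟩
    · intro a ha
      have := (Finset.mem_filter.1 (Finset.mem_filter.1 ha).1).2
      exact Finset.mem_filter.2 ⟨Finset.mem_univ _, this.2⟩
    · intro a _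
      rw [card_cell]
      exact le_kmax _
  have hG : G.card ≤ M2 k * ((ℓ * r + 2 * (r * (kmax k * r) * (kmax k * r))) * r) := by
    rw [← card_CP]
    refine card_le_fib G Prod.fst Prod.snd (fun a _ b _ h1 h2 => Prod.ext h1 h2) _
      (fun x => (PP Q).filter fun y => y.1 ∈ B x) _ ?_ ?_ ?_
    · intro a ha
      exact (Finset.mem_product.1 (Finset.mem_filter.1 ha).1).1
    · intro a ha
      exact Finset.mem_filter.2
        ⟨(Finset.mem_product.1 (Finset.mem_filter.1 ha).1).2, (Finset.mem_filter.1 ha).2⟩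
    · intro x _
      refine (card_le_fib _ Prod.fst Prod.snd (fun a _ b _ h1 h2 => Prod.ext h1 h2) (B x)
        (pt Q) r ?_ ?_ ?_).trans (Nat.mul_le_mul_right _ (hB x))
      · intro a ha
        exact (Finset.mem_filter.1 ha).2
      · intro a ha
        have := (Finset.mem_filter.1 (Finset.mem_filter.1 ha).1).2.2
        rw [this]
        exact (pt_spec hP _).2
      · intro a _
        exact (hP.1 _ (pt_spec hP a).1).le
  have hsub : ((CP k ×ˢ PP Q).filter fun t => ¬ ((¬ HasLoop (pt Q t.1.1) ∧ ¬ HasLoop (pt Q t.1.2)) ∧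
      (¬ HasLoop (pt Q t.2.1) ∧ ¬ Near Q (pt Q t.1.1) (pt Q t.2.1) ∧
        ¬ Near Q (pt Q t.1.2) (pt Q t.2.1)))) ⊆ ((C₁ ∪ C₂) ×ˢ PP Q) ∪ G := by
    intro t ht
    simp only [G, B, C₁, C₂, Finset.mem_union, Finset.mem_product, Finset.mem_filter,
      Finset.mem_univ, true_and] at ht ⊢
    tauto
  refine (Finset.card_le_card hsub).trans ((Finset.card_union_le _ _).trans (Nat.add_le_add ?_ hG))
  rw [Finset.card_product, card_PP hP]
  refine Nat.mul_le_mul_right _ ((Finset.card_union_le _ _).trans ?_)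
  omega

lemma ineq_forward {r ℓ : ℕ} (hℓ : 1 ≤ ℓ) :
    (Cset r k ℓ).ncard * (2 * ℓ * (Mtot k * Mtot k)) ≤
      (Cset r k (ℓ - 1)).ncard * (M2 k * (Mtot k * (r - 1))) +
      (Cset r k ℓ).ncard * (2 * ℓ *
      (2 * ((ℓ * r + r * (kmax k * r) * (kmax k * r)) * Mtot k) +
        Mtot k * (r * (kmax k * r)))) := by
  have fin₁ := Set.toFinite (Cset r k ℓ)
  have fin₂ := Set.toFinite (Cset r k (ℓ - 1))
  rw [Set.ncard_eq_toFinset_card _ fin₁, Set.ncard_eq_toFinset_card _ fin₂]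
  have key := double_count fin₁.toFinset fin₂.toFinset FG (fun Q => CP k ×ˢ PP Q)
    (fun t => img (sw t.1.1 t.1.2 t.2.1 t.2.2)) (fun t => img_injective _) (by
      rintro Q hQ ⟨⟨x₁, x₂⟩, y₁, y₂⟩ ht
      simp only [FG, LP, CP, PP, Finset.mem_filter, Finset.mem_product, Finset.mem_univ, true_and,
        and_true, Set.Finite.mem_toFinset] at ht hQ ⊢
      obtain ⟨⟨h1, h2, h3⟩, h4, h5, h6, h7, h8⟩ := ht
      obtain ⟨a, b, c⟩ := forward hQ hℓ h1 h2 h3 h4 h5 h6 h7 h8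
      exact ⟨a, ⟨h1, h2⟩, b, c⟩)
  have e2 : ∑ Q ∈ fin₂.toFinset, (CP k ×ˢ PP Q).card =
      fin₂.toFinset.card * (M2 k * (Mtot k * (r - 1))) := by
    rw [← smul_eq_mul (a := fin₂.toFinset.card)]
    apply Finset.sum_eq_card_nsmul
    intro Q hQ
    rw [Set.Finite.mem_toFinset] at hQ
    rw [Finset.card_product, card_CP, card_PP hQ.1.1]
  have e1 := Finset.card_nsmul_le_sum fin₁.toFinset (fun Q => (FG Q).card + 2 * ℓ *
      (2 * ((ℓ * r + r * (kmax k * r) * (kmax k * r)) * Mtot k) +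
        Mtot k * (r * (kmax k * r)))) _ (fun Q hQ => FG_lower ((Set.Finite.mem_toFinset _).1 hQ))
  rw [Finset.sum_add_distrib, Finset.sum_const, smul_eq_mul, smul_eq_mul] at e1
  rw [e2] at key
  omega

lemma ineq_reverse {r ℓ : ℕ} (hℓ : 1 ≤ ℓ) (hN : ℓ ≤ Nbound r k) :
    (Cset r k (ℓ - 1)).ncard * (M2 k * (Mtot k * (r - 1))) ≤
      (Cset r k ℓ).ncard * (2 * ℓ * (Mtot k * Mtot k)) +
      (Cset r k (ℓ - 1)).ncard * (2 * (ℓ * r * kmax k) * (Mtot k * (r - 1)) +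
      M2 k * ((ℓ * r + 2 * (r * (kmax k * r) * (kmax k * r))) * r)) := by
  have fin₁ := Set.toFinite (Cset r k ℓ)
  have fin₂ := Set.toFinite (Cset r k (ℓ - 1))
  rw [Set.ncard_eq_toFinset_card _ fin₁, Set.ncard_eq_toFinset_card _ fin₂]
  have key := double_count fin₂.toFinset fin₁.toFinset RG (fun Q => LP Q ×ˢ Finset.univ)
    (fun t => img (sw t.1.1 t.1.2 t.2.1 t.2.2)) (fun t => img_injective _) (by
      rintro Q hQ ⟨⟨x₁, x₂⟩, y₁, y₂⟩ ht
      simp only [RG, LP, CP, PP, Finset.mem_filter, Finset.mem_product, Finset.mem_univ, true_and,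
        and_true, Set.Finite.mem_toFinset] at ht hQ ⊢
      obtain ⟨⟨⟨h1, h2⟩, h3, h4⟩, ⟨h5, h6⟩, h7, h8, h9⟩ := ht
      obtain ⟨a, b⟩ := reverse hQ hℓ hN h1 h2 h5 h6 h3 h4 h7 h8 h9
      exact ⟨a, h1, h2, b⟩)
  have e2 : ∑ Q ∈ fin₁.toFinset, (LP Q ×ˢ (Finset.univ : Finset (Pts k × Pts k))).card =
      fin₁.toFinset.card * (2 * ℓ * (Mtot k * Mtot k)) := by
    rw [← smul_eq_mul (a := fin₁.toFinset.card)]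
    apply Finset.sum_eq_card_nsmul
    intro Q hQ
    rw [Set.Finite.mem_toFinset] at hQ
    rw [Finset.card_product, card_LP hQ, ← Finset.univ_product_univ, Finset.card_product, card_pts]
  have e1 := Finset.card_nsmul_le_sum fin₂.toFinset (fun Q => (RG Q).card + 
      (2 * (ℓ * r * kmax k) * (Mtot k * (r - 1)) +
      M2 k * ((ℓ * r + 2 * (r * (kmax k * r) * (kmax k * r))) * r))) _
      (fun Q hQ => RG_lower ((Set.Finite.mem_toFinset _).1 hQ))
  rw [Finset.sum_add_distrib, Finset.sum_const, smul_eq_mul, smul_eq_mul] at e1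
  rw [e2] at key
  omega

lemma M2_pos (hk : 2 ≤ kmax k) : 0 < M2 k := by
  by_contra h
  have h0 : M2 k = 0 := by omega
  unfold M2 at h0
  rw [Finset.sum_eq_zero_iff] at h0
  have : kmax k ≤ 1 := by
    refine Finset.sup_le fun i hi => ?_
    have := h0 i hi
    rcases Nat.mul_eq_zero.1 this with h | h <;> omega
  omega

lemma M2_le : M2 k ≤ kmax k * Mtot k := by
  unfold M2 Mtot
  rw [Finset.mul_sum]
  refine Finset.sum_le_sum fun i _ => ?_
  rw [mul_comm]
  exact Nat.mul_le_mul_right _ ((Nat.sub_le _ _).trans (le_kmax i))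

lemma Nbound_le {r : ℕ} (hr : 1 ≤ r) :
    (Nbound r k : ℝ) ≤ max (Real.log (Mtot k)) (9 * ((r : ℝ) - 1) * (M2 k : ℝ) / (Mtot k : ℝ)) + 1 := by
  have hr' : (1 : ℝ) ≤ r := by exact_mod_cast hr
  unfold Nbound
  rw [Nat.cast_max]
  have h1 := (Nat.ceil_lt_add_one (Real.log_natCast_nonneg (Mtot k))).le
  have h2 : (0 : ℝ) ≤ 9 * ((r : ℝ) - 1) * (M2 k : ℝ) / (Mtot k : ℝ) := by
    apply div_nonneg _ (Nat.cast_nonneg _)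
    apply mul_nonneg _ (Nat.cast_nonneg _)
    linarith
  have h3 := (Nat.ceil_lt_add_one h2).le
  refine max_le (h1.trans ?_) (h3.trans ?_)
  · gcongr; exact le_max_left _ _
  · gcongr; exact le_max_right _ _

lemma small_F {r : ℕ} {K M m l : ℝ} (hR : (3 : ℝ) ≤ r) (hK : 2 ≤ K) (hM : 0 < M)
    (hmK : m ≤ K * M) (hδ : K ^ 3 ≤ (1 / (20 * (r : ℝ) ^ 3)) ^ 2 * M) (hl : 1 ≤ l)
    (hN : l ≤ max (Real.log M) (9 * ((r : ℝ) - 1) * m / M) + 1) :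
    2 * (l * r + r * (K * r) * (K * r)) + r * (K * r) ≤ M / 2 := by
  set R : ℝ := (r : ℝ)
  set s : ℝ := 1 / (20 * R ^ 3) with hs
  have hR3 : 0 < R ^ 3 := by positivity
  have hs0 : 0 < s := by positivity
  have hsR : s * R ^ 3 = 1 / 20 := by rw [hs]; field_simp
  have hR3' : (27 : ℝ) ≤ R ^ 3 := by
    calc (27 : ℝ) = 3 ^ 3 := by norm_num
      _ ≤ R ^ 3 := by gcongr
  have hs1 : s ≤ 1 := by nlinarith
  have hK3 : (8 : ℝ) ≤ K ^ 3 := by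
    calc (8 : ℝ) = 2 ^ 3 := by norm_num
      _ ≤ K ^ 3 := by gcongr
  have hss : s ^ 2 * M ≤ s * M := by
    have : s ^ 2 ≤ s := by nlinarith
    gcongr
  have hsM : K ^ 3 ≤ s * M := hδ.trans hss
  have hK2 : K ^ 2 ≤ s * M := by nlinarith [sq_nonneg K]
  have hK1 : K ≤ s * M := by nlinarith
  have hsq := Real.sq_sqrt hM.le
  have hsq0 := Real.sqrt_pos.2 hM
  have h1 : 1 ≤ s * √M := by
    by_contra h
    push Not at h
    have : (s * √M) ^ 2 < 1 := by
      have : 0 < s * √M := by positivity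
      nlinarith
    rw [mul_pow, hsq] at this
    linarith
  have hsqM : √M ≤ s * M := by
    calc √M = 1 * √M := by ring
      _ ≤ (s * √M) * √M := by gcongr
      _ = s * M := by rw [mul_assoc, ← sq, hsq]
  have hlog : Real.log M ≤ 2 * (s * M) := by
    have h2 : Real.log M = 2 * Real.log (√M) := by
      rw [Real.log_sqrt hM.le]; ring
    have h3 := Real.log_le_sub_one_of_pos hsq0
    linarith
  have hm : 9 * (R - 1) * m / M ≤ 9 * R * K := by
    rw [div_le_iff₀ hM]
    calc 9 * (R - 1) * m ≤ 9 * (R - 1) * (K * M) := by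
          apply mul_le_mul_of_nonneg_left hmK; linarith
      _ ≤ 9 * R * K * M := by
          have : 0 < K * M := by positivity
          nlinarith
  have hlb : l ≤ 2 * (s * M) + 9 * R * (s * M) + s * M := by
    refine hN.trans ?_
    have h9 : 9 * R * K ≤ 9 * R * (s * M) := by gcongr
    have h0 : 0 ≤ 9 * R * (s * M) := by positivity
    have h0' : 0 < s * M := by positivity
    have : max (Real.log M) (9 * (R - 1) * m / M) ≤ 2 * (s * M) + 9 * R * (s * M) :=
      max_le (by linarith) (by linarith)
    linarith
  have hlR : l * R ≤ (3 * R + 9 * R ^ 2) * (s * M) := by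
    calc l * R ≤ (2 * (s * M) + 9 * R * (s * M) + s * M) * R := by gcongr
      _ = _ := by ring
  have hsM0 : 0 < s * M := by positivity
  have e2 : R * (K * R) * (K * R) ≤ R ^ 3 * (s * M) := by
    calc R * (K * R) * (K * R) = R ^ 3 * K ^ 2 := by ring
      _ ≤ _ := by gcongr
  have e3 : R * (K * R) ≤ R ^ 2 * (s * M) := by
    calc R * (K * R) = R ^ 2 * K := by ring
      _ ≤ _ := by gcongr
  have hR2 : R ^ 2 * 3 ≤ R ^ 3 := by
    calc R ^ 2 * 3 ≤ R ^ 2 * R := by gcongr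
      _ = R ^ 3 := by ring
  have hR1 : R * 9 ≤ R ^ 3 := by nlinarith
  have hfin : 2 * ((3 * R + 9 * R ^ 2) + R ^ 3) + R ^ 2 ≤ 10 * R ^ 3 := by linarith
  calc _ ≤ 2 * ((3 * R + 9 * R ^ 2) * (s * M) + R ^ 3 * (s * M)) + R ^ 2 * (s * M) := by linarith
    _ = (2 * ((3 * R + 9 * R ^ 2) + R ^ 3) + R ^ 2) * (s * M) := by ring
    _ ≤ 10 * R ^ 3 * (s * M) := by gcongr
    _ = 10 * (s * R ^ 3) * M := by ring
    _ = M / 2 := by rw [hsR]; ring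

lemma arith_core {R K M m l c d : ℝ} (hR : 3 ≤ R) (hK : 2 ≤ K) (hM : 0 < M) (hm : 0 < m)
    (hmK : m ≤ K * M) (hl : 1 ≤ l) (hd : 0 < d) (hc : 0 ≤ c)
    (h1 : c * (2 * l * (M * M)) ≤ d * (m * (M * (R - 1))) +
      c * (2 * l * (2 * ((l * R + R * (K * R) * (K * R)) * M) + M * (R * (K * R)))))
    (h2 : d * (m * (M * (R - 1))) ≤ c * (2 * l * (M * M)) +
      d * (2 * (l * R * K) * (M * (R - 1)) +
      m * ((l * R + 2 * (R * (K * R) * (K * R))) * R)))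
    (hF : 2 * (l * R + R * (K * R) * (K * R)) + R * (K * R) ≤ M / 2) :
    |c * (2 * l * M) / (d * (R - 1) * m) - 1| ≤ 6 * R ^ 4 * (K ^ 3 + l * K) / m := by
  have hR1 : 0 < R - 1 := by linarith
  have hA : 0 < d * (R - 1) * m := by positivity
  set A := d * (R - 1) * m with hAdef
  set X := c * (2 * l * M) with hX
  set F := 2 * (l * R + R * (K * R) * (K * R)) + R * (K * R) with hFdef
  have hX0 : 0 ≤ X := by positivity
  have hF0 : 0 ≤ F := by positivity
  have p1 : X * M ≤ A * M + X * F := by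
    have e1 : X * M = c * (2 * l * (M * M)) := by rw [hX]; ring
    have e2 : A * M = d * (m * (M * (R - 1))) := by rw [hAdef]; ring
    have e3 : X * F = c * (2 * l * (2 * ((l * R + R * (K * R) * (K * R)) * M) + M * (R * (K * R)))) := by
      rw [hX, hFdef]; ring
    rw [e1, e2, e3]; exact h1
  have p2 : A * M ≤ X * M + d * (2 * (l * R * K) * (M * (R - 1)) +
      m * ((l * R + 2 * (R * (K * R) * (K * R))) * R)) := by
    have e1 : X * M = c * (2 * l * (M * M)) := by rw [hX]; ring
    have e2 : A * M = d * (m * (M * (R - 1))) := by rw [hAdef]; ring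
    rw [e1, e2]; exact h2
  clear_value X F
  have hR34 : R ^ 3 ≤ R ^ 4 := by
    calc R ^ 3 = R ^ 3 * 1 := by ring
      _ ≤ R ^ 3 * R := by gcongr; linarith
      _ = R ^ 4 := by ring
  have hR23 : R ^ 2 ≤ R ^ 3 := by
    calc R ^ 2 = R ^ 2 * 1 := by ring
      _ ≤ R ^ 2 * R := by gcongr; linarith
      _ = R ^ 3 := by ring
  have hR12 : R ≤ R ^ 2 := by nlinarith
  have hK23 : K ^ 2 ≤ K ^ 3 := by
    calc K ^ 2 = K ^ 2 * 1 := by ring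
      _ ≤ K ^ 2 * K := by gcongr; linarith
      _ = K ^ 3 := by ring
  have hlK : 0 < l * K := by positivity
  have hK3 : 0 < K ^ 3 := by positivity
  set Y := 6 * R ^ 4 * (K ^ 3 + l * K) with hY
  have hY0 : 0 ≤ Y := by positivity
  have q1 : 2 * F * K ≤ Y := by
    calc 2 * F * K = 4 * (R * (l * K)) + 4 * (R ^ 3 * K ^ 3) + 2 * (R ^ 2 * K ^ 2) := by
          rw [hFdef]; ring
      _ ≤ 4 * (R ^ 4 * (l * K)) + 4 * (R ^ 4 * K ^ 3) + 2 * (R ^ 4 * K ^ 3) := by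
          have : R ≤ R ^ 4 := by linarith
          have : R ^ 2 ≤ R ^ 4 := by linarith
          gcongr
      _ ≤ Y := by
          have : 0 < R ^ 4 * (l * K) := by positivity
          rw [hY]; linarith
  have q2 : 2 * l * R * K + K * (l * R + 2 * (R * (K * R) * (K * R))) * R ≤ Y := by
    calc _ = 2 * (R * (l * K)) + R ^ 2 * (l * K) + 2 * (R ^ 4 * K ^ 3) := by ring
      _ ≤ 2 * (R ^ 4 * (l * K)) + R ^ 4 * (l * K) + 2 * (R ^ 4 * K ^ 3) := by
          have : R ≤ R ^ 4 := by linarith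
          have : R ^ 2 ≤ R ^ 4 := by linarith
          gcongr
      _ ≤ Y := by
          have : 0 < R ^ 4 * (l * K) := by positivity
          have : 0 < R ^ 4 * K ^ 3 := by positivity
          rw [hY]; linarith
  have eq1 : X / A - 1 = (X - A) / A := by field_simp
  rw [eq1, abs_le]
  constructor
  · rw [neg_le, ← neg_div, div_le_div_iff₀ hA hm]
    have goal2 : (A - X) * m * M ≤ Y * A * M := by
      have s1 : (A - X) * M ≤ d * (2 * (l * R * K) * (M * (R - 1)) +
        m * ((l * R + 2 * (R * (K * R) * (K * R))) * R)) := by linarith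
      set G := l * R + 2 * (R * (K * R) * (K * R)) with hG
      have hG0 : 0 < G := by positivity
      have s3 : m * (m * (d * G * R)) ≤ (K * M) * (A * (G * R)) := by
        have : m * (d * G * R) ≤ A * (G * R) := by
          rw [hAdef]
          have : 0 < d * m * (G * R) := by positivity
          nlinarith
        gcongr
      calc (A - X) * m * M = (A - X) * M * m := by ring
        _ ≤ d * (2 * (l * R * K) * (M * (R - 1)) + m * (G * R)) * m := by gcongr
        _ = 2 * l * R * K * (A * M) + m * (m * (d * G * R)) := by rw [hAdef]; ring
        _ ≤ 2 * l * R * K * (A * M) + (K * M) * (A * (G * R)) := by gcongr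
        _ = (2 * l * R * K + K * G * R) * (A * M) := by ring
        _ ≤ Y * (A * M) := by gcongr
        _ = Y * A * M := by ring
    have := le_of_mul_le_mul_right goal2 hM
    linarith
  · rw [div_le_div_iff₀ hA hm]
    by_cases hXA : X ≤ A
    · have : (X - A) * m ≤ 0 := mul_nonpos_of_nonpos_of_nonneg (by linarith) hm.le
      have : 0 ≤ Y * A := by positivity
      linarith
    · push Not at hXA
      have hX2 : X ≤ 2 * A := by
        have : X * F ≤ X * (M / 2) := by gcongr
        have : X * M ≤ 2 * A * M := by linarith
        exact le_of_mul_le_mul_right this hM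
      have t1 : (X - A) * M ≤ 2 * A * F := by
        have : X * F ≤ 2 * A * F := by gcongr
        linarith
      calc (X - A) * m ≤ (X - A) * (K * M) := by
            apply mul_le_mul_of_nonneg_left hmK; linarith
        _ = (X - A) * M * K := by ring
        _ ≤ 2 * A * F * K := by gcongr
        _ = 2 * F * K * A := by ring
        _ ≤ Y * A := by gcongr

end Helpers

/-- ratio of |C_ℓ| to |C_{ℓ-1}| (Lemma 5 of the paper). -/
theorem Cset_ratio (r : ℕ) (hr : 3 ≤ r) :
    ∃ C δ : ℝ, 0 < C ∧ 0 < δ ∧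
      ∀ (n : ℕ) (k : Fin n → ℕ) (ℓ : ℕ),
        r ∣ Mtot k → 2 ≤ kmax k → (kmax k : ℝ) ^ 3 ≤ δ * (Mtot k : ℝ) →
        1 ≤ ℓ → ℓ ≤ Nbound r k → (∀ j ≤ ℓ, (Cset r k j).Nonempty) →
        ∃ E : ℝ, |E| ≤ C * ((kmax k : ℝ) ^ 3 + (ℓ : ℝ) * (kmax k : ℝ)) / (M2 k : ℝ) ∧
          (Set.ncard (Cset r k ℓ) : ℝ) =
            (Set.ncard (Cset r k (ℓ - 1)) : ℝ) *
              (((r : ℝ) - 1) * (M2 k : ℝ) / (2 * (ℓ : ℝ) * (Mtot k : ℝ))) * (1 + E) := by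
  have hR : (3 : ℝ) ≤ r := by exact_mod_cast hr
  refine ⟨6 * (r : ℝ) ^ 4, (1 / (20 * (r : ℝ) ^ 3)) ^ 2, by positivity, by positivity, ?_⟩
  intro n k ℓ _ hk hδ hℓ hN hne
  have hM2 := M2_pos hk
  have hM2K := M2_le (k := k)
  have hK : (2 : ℝ) ≤ kmax k := by exact_mod_cast hk
  have hl : (1 : ℝ) ≤ ℓ := by exact_mod_cast hℓ
  have hm : (0 : ℝ) < M2 k := by exact_mod_cast hM2
  have hmK : (M2 k : ℝ) ≤ kmax k * Mtot k := by exact_mod_cast hM2K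
  have hM : (0 : ℝ) < Mtot k := by
    by_contra h
    have : (kmax k : ℝ) * Mtot k ≤ 0 := mul_nonpos_of_nonneg_of_nonpos (by linarith) (by linarith)
    linarith
  have hd : (0 : ℝ) < (Cset r k (ℓ - 1)).ncard := by
    have := (Set.ncard_pos (Set.toFinite _)).2 (hne (ℓ - 1) (by omega))
    exact_mod_cast this
  have h1 := ineq_forward (k := k) (r := r) hℓ
  have h2 := ineq_reverse (k := k) (r := r) hℓ hN
  have hr1 : ((r - 1 : ℕ) : ℝ) = (r : ℝ) - 1 := by
    rw [Nat.cast_sub (by omega)]; simp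
  have h1' := (Nat.cast_le (α := ℝ)).2 h1
  have h2' := (Nat.cast_le (α := ℝ)).2 h2
  push_cast [hr1] at h1' h2'
  have hF := small_F (r := r) hR hK hM hmK hδ hl (by
    have h3 : ((Nbound r k : ℕ) : ℝ) ≤ _ := Nbound_le (r := r) (k := k) (by omega)
    have h4 : (ℓ : ℝ) ≤ Nbound r k := by exact_mod_cast hN
    exact h4.trans h3)
  have key := arith_core hR hK hM hm hmK hl hd (Nat.cast_nonneg _) h1' h2' hF
  refine ⟨_, key, ?_⟩
  have : (r : ℝ) - 1 ≠ 0 := by linarith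
  have hl0 : (ℓ : ℝ) ≠ 0 := by linarith
  field_simp
  ring
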